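/- arXiv:2005.05427 — 3 statements merged into one kernel-verified Lean document; each statement's English description precedes it below -/
import Mathlib

section
/- Let A be any set-linearizable implementation of the set-concurrent queue with multiplicity. Then every execution of A containing no two concurrent Deq operations is linearizable with respect to the sequential queue. -/
/-- Operations of a queue over items in ℕ. -/
inductive QueueOp
  | enq (x : ℕ)
  | deq
  deriving DecidableEq

/-- Possible outputs: `ok` (= true, for enqueue), an item, or empty (ε). -/
inductive QueueRes
  | ok
  | val (x : ℕ)
  | empty
  deriving DecidableEq

/-- A concurrent history (execution at the interface level): `m` operations, each
with its kind, its invocation time, and, if it is completed, its response time and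
its output (`none` in both fields means the operation is pending). -/
structure ConcHistory (Op Res : Type) where
  m : ℕ
  op : Fin m → Op
  inv : Fin m → ℕ
  ret : Fin m → Option ℕ
  out : Fin m → Option Res

/-- `op i` precedes `op j`: the response of `i` occurs before the invocation of `j`. -/
def ConcHistory.precedes {Op Res : Type} (h : ConcHistory Op Res) (i j : Fin h.m) : Prop :=
  ∃ t, h.ret i = some t ∧ t < h.inv j

/-- Two operations are concurrent if they are incomparable w.r.t. `precedes`. -/
def ConcHistory.concurrent {Op Res : Type} (h : ConcHistory Op Res) (i j : Fin h.m) : Prop :=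
  ¬ h.precedes i j ∧ ¬ h.precedes j i

/-- Transition of the set-concurrent queue with multiplicity taken by a concurrency
class `C` of operations (given by their indices in a history): either a single
enqueue (appending at the tail), or between 1 and `n` concurrent dequeues all
returning the head item, or a single dequeue returning empty on the empty queue. -/
def queueClassDelta (n : ℕ) {m : ℕ} (op : Fin m → QueueOp) (out : Fin m → QueueRes)
    (q : List ℕ) (C : Finset (Fin m)) (q' : List ℕ) : Prop :=
  (∃ i x, C = {i} ∧ op i = QueueOp.enq x ∧ out i = QueueRes.ok ∧ q' = q ++ [x]) ∨
  (∃ x, q = x :: q' ∧ 1 ≤ C.card ∧ C.card ≤ n ∧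
      ∀ i ∈ C, op i = QueueOp.deq ∧ out i = QueueRes.val x) ∨
  (∃ i, C = {i} ∧ op i = QueueOp.deq ∧ out i = QueueRes.empty ∧ q = [] ∧ q' = [])

/-- A set-linearization of a history `h` w.r.t. the set-concurrent queue with
multiplicity (`n` processes): operations are assigned to `K` linearly ordered
concurrency classes (every completed operation is assigned, pending ones may be),
outputs agree with those of `h` on completed operations, consecutive classes are
related by the transition relation starting from the empty queue, and the
real-time order of `h` is respected. -/
structure SetLinearization (n : ℕ) (h : ConcHistory QueueOp QueueRes) where
  K : ℕ
  cls : Fin h.m → Option (Fin K)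
  lout : Fin h.m → QueueRes
  states : Fin (K + 1) → List ℕ
  complete_assigned : ∀ i, (h.out i).isSome → (cls i).isSome
  out_agree : ∀ i r, h.out i = some r → lout i = r
  init : states 0 = []
  classes_nonempty : ∀ k : Fin K, ∃ i, cls i = some k
  step : ∀ k : Fin K,
    queueClassDelta n h.op lout (states k.castSucc)
      (Finset.univ.filter (fun i => cls i = some k)) (states k.succ)
  order : ∀ i j ki kj, h.precedes i j → cls i = some ki → cls j = some kj →
    (ki : ℕ) < (kj : ℕ)

/-- A history is set-linearizable w.r.t. the set-concurrent queue with multiplicity. -/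
def SetLinearizable (n : ℕ) (h : ConcHistory QueueOp QueueRes) : Prop :=
  Nonempty (SetLinearization n h)

/-- Transition of the sequential queue. -/
def SeqQueueDelta (q : List ℕ) (p : QueueOp × QueueRes) (q' : List ℕ) : Prop :=
  (∃ x, p = (QueueOp.enq x, QueueRes.ok) ∧ q' = q ++ [x]) ∨
  (∃ x, q = x :: q' ∧ p = (QueueOp.deq, QueueRes.val x)) ∨
  (q = [] ∧ q' = [] ∧ p = (QueueOp.deq, QueueRes.empty))

/-- A sequential execution of the sequential queue. -/
inductive SeqQueueExec : List ℕ → List (QueueOp × QueueRes) → List ℕ → Prop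
  | nil (q : List ℕ) : SeqQueueExec q [] q
  | cons {q q' q'' : List ℕ} {p : QueueOp × QueueRes} {ps : List (QueueOp × QueueRes)} :
      SeqQueueDelta q p q' → SeqQueueExec q' ps q'' → SeqQueueExec q (p :: ps) q''

/-- A linearization of a history `h` w.r.t. the sequential queue: a sequence of
(distinct) operations of `h` containing all completed ones, whose outputs agree
with `h`, respecting the real-time order of `h`, and forming a sequential execution
of the queue from the empty initial state. -/
structure Linearization (h : ConcHistory QueueOp QueueRes) where
  seq : List (Fin h.m)
  lout : Fin h.m → QueueRes
  nodup : seq.Nodup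
  complete_mem : ∀ i, (h.out i).isSome → i ∈ seq
  out_agree : ∀ i r, h.out i = some r → lout i = r
  order : ∀ k1 k2 : Fin seq.length,
    h.precedes (seq.get k1) (seq.get k2) → (k1 : ℕ) < (k2 : ℕ)
  valid : ∃ qf, SeqQueueExec [] (seq.map (fun i => (h.op i, lout i))) qf

/-- A history is linearizable w.r.t. the sequential queue. -/
def Linearizable (h : ConcHistory QueueOp QueueRes) : Prop :=
  Nonempty (Linearization h)

/-- Composing sequential queue steps along a finite family of states. -/
theorem SeqQueueExec.ofFn : ∀ {K : ℕ} (states : Fin (K + 1) → List ℕ)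
    (p : Fin K → QueueOp × QueueRes),
    (∀ k, SeqQueueDelta (states k.castSucc) (p k) (states k.succ)) →
    SeqQueueExec (states 0) (List.ofFn p) (states (Fin.last K))
  | 0, _, _, _ => .nil _
  | K + 1, states, p, hstep => by
    rw [List.ofFn_succ]
    exact .cons (hstep 0)
      (SeqQueueExec.ofFn (fun k => states k.succ) (fun k => p k.succ) fun k => hstep k.succ)

/-- Every member of a concurrency class, taken alone, is a step of the sequential queue. -/
theorem queueClassDelta.seqQueueDelta {n m : ℕ} {op : Fin m → QueueOp}
    {out : Fin m → QueueRes} {q q' : List ℕ} {C : Finset (Fin m)} {i : Fin m}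
    (hC : queueClassDelta n op out q C q') (hi : i ∈ C) :
    SeqQueueDelta q (op i, out i) q' := by
  rcases hC with ⟨j, x, rfl, h1, h2, h3⟩ | ⟨x, h1, -, -, h2⟩ | ⟨j, rfl, h1, h2, h3, h4⟩
  · obtain rfl := Finset.mem_singleton.1 hi
    exact .inl ⟨x, by rw [h1, h2], h3⟩
  · exact .inr (.inl ⟨x, h1, by rw [(h2 i hi).1, (h2 i hi).2]⟩)
  · obtain rfl := Finset.mem_singleton.1 hi
    exact .inr (.inr ⟨h3, h4, by rw [h1, h2]⟩)

/-- Distinct members of a concurrency class are dequeues. -/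
theorem queueClassDelta.eq_or_deq {n m : ℕ} {op : Fin m → QueueOp}
    {out : Fin m → QueueRes} {q q' : List ℕ} {C : Finset (Fin m)} {i j : Fin m}
    (hC : queueClassDelta n op out q C q') (hi : i ∈ C) (hj : j ∈ C) :
    i = j ∨ (op i = QueueOp.deq ∧ op j = QueueOp.deq) := by
  rcases hC with ⟨k, x, rfl, -⟩ | ⟨x, -, -, -, h2⟩ | ⟨k, rfl, -⟩
  · simp_all
  · exact .inr ⟨(h2 i hi).1, (h2 j hj).1⟩
  · simp_all

/-- Let `A` be any set-linearizable implementation (identified with its set of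
histories) of the set-concurrent queue with multiplicity.  Then every execution of
`A` containing no two concurrent Deq operations is linearizable with respect to the
sequential queue. -/
theorem setLinearizableQueue_noConcurrentDeqs_linearizable
    (n : ℕ) (A : Set (ConcHistory QueueOp QueueRes))
    (hA : ∀ h ∈ A, SetLinearizable n h)
    (h : ConcHistory QueueOp QueueRes) (hmem : h ∈ A)
    (hdeqs : ∀ i j : Fin h.m, i ≠ j → h.op i = QueueOp.deq → h.op j = QueueOp.deq →
      ¬ h.concurrent i j) :
    Linearizable h := by
  obtain ⟨L⟩ := hA h hmem
  have hinj : ∀ i j k, L.cls i = some k → L.cls j = some k → i = j := by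
    intro i j k hi hj
    rcases (L.step k).eq_or_deq (i := i) (j := j) (by simpa using hi) (by simpa using hj)
      with hij | ⟨hdi, hdj⟩
    · exact hij
    · by_contra hne
      exact hdeqs i j hne hdi hdj
        ⟨fun hp => lt_irrefl _ (L.order i j k k hp hi hj),
          fun hp => lt_irrefl _ (L.order j i k k hp hj hi)⟩
  choose f hf using L.classes_nonempty
  refine ⟨⟨List.ofFn f, L.lout, ?_, ?_, L.out_agree, ?_, L.states (Fin.last L.K), ?_⟩⟩
  · refine List.nodup_ofFn.2 fun a b hab => ?_
    have hb := hf b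
    rw [← hab, hf a] at hb
    exact Option.some.inj hb
  · intro i hi
    obtain ⟨k, hk⟩ := Option.isSome_iff_exists.1 (L.complete_assigned i hi)
    exact List.mem_ofFn.2 ⟨k, hinj _ _ k (hf k) hk⟩
  · intro k1 k2 hp
    rw [List.get_ofFn, List.get_ofFn] at hp
    exact L.order _ _ _ _ hp (hf _) (hf _)
  · rw [List.map_ofFn, ← L.init]
    exact SeqQueueExec.ofFn L.states _ fun k =>
      (L.step k).seqQueueDelta (by simpa using hf k)
end

section
/- Let A be any set-linearizable implementation of the set-concurrent queue with multiplicity. If in an execution of A two Deq operations return the same (non-empty) value, then those two operations are concurrent. -/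
namespace SetLinearization

variable {n : ℕ} {h : ConcHistory QueueOp QueueRes}

/-- Some enqueue of `x` is linearized in a class before position `k`. -/
def EnqBefore (L : SetLinearization n h) (x k : ℕ) : Prop :=
  ∃ (i : Fin h.m) (c : Fin L.K), h.op i = QueueOp.enq x ∧ L.cls i = some c ∧ (c : ℕ) < k

theorem EnqBefore.mono {L : SetLinearization n h} {x k l : ℕ} (hx : L.EnqBefore x k)
    (hkl : k ≤ l) : L.EnqBefore x l := by
  obtain ⟨i, c, hop, hc, hck⟩ := hx
  exact ⟨i, c, hop, hc, hck.trans_le hkl⟩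

/-- A transition appends an item enqueued in its class, removes the head, or changes nothing. -/
theorem step_cases (L : SetLinearization n h) (k : Fin L.K) :
    (∃ i x, h.op i = QueueOp.enq x ∧ L.cls i = some k ∧
      L.states k.succ = L.states k.castSucc ++ [x]) ∨
    (∃ x, L.states k.castSucc = x :: L.states k.succ) ∨
    L.states k.succ = L.states k.castSucc := by
  rcases L.step k with ⟨i, x, hC, hop, -, hq⟩ | ⟨x, hq, -⟩ | ⟨i, -, -, -, hq, hq'⟩
  · have hi : i ∈ Finset.univ.filter (fun i => L.cls i = some k) := by simp [hC]
    exact Or.inl ⟨i, x, hop, (Finset.mem_filter.mp hi).2, hq⟩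
  · exact Or.inr (Or.inl ⟨x, hq⟩)
  · exact Or.inr (Or.inr (hq'.trans hq.symm))

theorem states_eq_cons_of_lout_eq_val (L : SetLinearization n h) {i : Fin h.m} {k : Fin L.K}
    {x : ℕ} (hk : L.cls i = some k) (hx : L.lout i = QueueRes.val x) :
    L.states k.castSucc = x :: L.states k.succ := by
  have hi : i ∈ Finset.univ.filter (fun i => L.cls i = some k) := by simp [hk]
  rcases L.step k with ⟨i', y, hC, -, ho, -⟩ | ⟨y, hq, -, -, hall⟩ | ⟨i', hC, -, ho, -⟩
  · rw [hC, Finset.mem_singleton] at hi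
    subst hi
    simp [hx] at ho
  · obtain rfl : x = y := by simpa [hx] using (hall i hi).2
    exact hq
  · rw [hC, Finset.mem_singleton] at hi
    subst hi
    simp [hx] at ho

theorem enqBefore_of_mem_states (L : SetLinearization n h) (k : Fin (L.K + 1)) :
    ∀ x ∈ L.states k, L.EnqBefore x k := by
  induction k using Fin.induction with
  | zero => simp [L.init]
  | succ k ih =>
    intro x hx
    have old (hx' : x ∈ L.states k.castSucc) : L.EnqBefore x k.succ :=
      (ih x hx').mono (by simp)
    rcases L.step_cases k with ⟨i, y, hop, hc, hq⟩ | ⟨y, hq⟩ | hq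
    · rw [hq, List.mem_append, List.mem_singleton] at hx
      rcases hx with hx | rfl
      · exact old hx
      · exact ⟨i, k, hop, hc, by simp⟩
    · exact old (by simp [hq, hx])
    · exact old (hq ▸ hx)

theorem not_enqBefore_of_enq
    (henq : ∀ (i j : Fin h.m) (x : ℕ),
      h.op i = QueueOp.enq x → h.op j = QueueOp.enq x → i = j)
    (L : SetLinearization n h) {i : Fin h.m} {x : ℕ} {k : Fin L.K}
    (hop : h.op i = QueueOp.enq x) (hk : L.cls i = some k) : ¬ L.EnqBefore x k := by
  rintro ⟨j, c, hj, hc, hck⟩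
  obtain rfl := henq i j x hop hj
  obtain rfl : k = c := Option.some_injective _ (hk.symm.trans hc)
  exact hck.false

theorem nodup_states
    (henq : ∀ (i j : Fin h.m) (x : ℕ),
      h.op i = QueueOp.enq x → h.op j = QueueOp.enq x → i = j)
    (L : SetLinearization n h) (k : Fin (L.K + 1)) : (L.states k).Nodup := by
  induction k using Fin.induction with
  | zero => simp [L.init]
  | succ k ih =>
    rcases L.step_cases k with ⟨i, x, hop, hc, hq⟩ | ⟨x, hq⟩ | hq
    · rw [hq, ← List.concat_eq_append]
      exact ih.concat fun hx =>
        not_enqBefore_of_enq henq L hop hc (L.enqBefore_of_mem_states _ x hx)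
    · rw [hq] at ih
      exact ih.of_cons
    · rwa [hq]

/-- An item that has been removed from the queue never comes back. -/
theorem notMem_states_of_lt
    (henq : ∀ (i j : Fin h.m) (x : ℕ),
      h.op i = QueueOp.enq x → h.op j = QueueOp.enq x → i = j)
    (L : SetLinearization n h) {k : Fin L.K} {x : ℕ}
    (hx : L.states k.castSucc = x :: L.states k.succ) (l : Fin (L.K + 1))
    (hkl : (k : ℕ) < l) : x ∉ L.states l := by
  induction l using Fin.induction with
  | zero => simp at hkl
  | succ l ih =>
    have hx_enq : L.EnqBefore x k := L.enqBefore_of_mem_states k.castSucc x (by simp [hx])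
    rcases (Nat.lt_succ_iff.mp hkl).eq_or_lt with heq | hlt
    · obtain rfl := Fin.ext heq
      have hnd := nodup_states henq L k.castSucc
      rw [hx] at hnd
      exact hnd.notMem
    · have hl := ih hlt
      rcases L.step_cases l with ⟨i, y, hop, hc, hq⟩ | ⟨y, hq⟩ | hq
      · rw [hq, List.mem_append, List.mem_singleton]
        rintro (hmem | rfl)
        · exact hl hmem
        · exact not_enqBefore_of_enq henq L hop hc (hx_enq.mono hlt.le)
      · exact fun hmem => hl (by simp [hq, hmem])
      · rwa [hq]

/-- If every item is enqueued at most once, operations returning the same item can not be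
ordered in real time. -/
theorem not_precedes_of_out_eq_val
    (henq : ∀ (i j : Fin h.m) (x : ℕ),
      h.op i = QueueOp.enq x → h.op j = QueueOp.enq x → i = j)
    (L : SetLinearization n h) {i j : Fin h.m} {x : ℕ}
    (hi : h.out i = some (QueueRes.val x)) (hj : h.out j = some (QueueRes.val x)) :
    ¬ h.precedes i j := by
  intro hp
  obtain ⟨ki, hki⟩ := Option.isSome_iff_exists.mp (L.complete_assigned i (by simp [hi]))
  obtain ⟨kj, hkj⟩ := Option.isSome_iff_exists.mp (L.complete_assigned j (by simp [hj]))
  have hsi := L.states_eq_cons_of_lout_eq_val hki (L.out_agree i _ hi)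
  have hsj := L.states_eq_cons_of_lout_eq_val hkj (L.out_agree j _ hj)
  exact notMem_states_of_lt henq L hsi kj.castSucc (L.order i j ki kj hp hki hkj)
    (by simp [hsj])

end SetLinearization

/-- Let `A` be any set-linearizable implementation (identified with its set of
histories) of the set-concurrent queue with multiplicity, where every item is
enqueued at most once.  If in an execution of `A` two distinct Deq operations
return the same (non-empty) value, then those two operations are concurrent. -/
theorem setLinearizableQueue_sameDeqValue_concurrent
    (n : ℕ) (A : Set (ConcHistory QueueOp QueueRes))
    (hA : ∀ h ∈ A, SetLinearizable n h)
    (h : ConcHistory QueueOp QueueRes) (hmem : h ∈ A)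
    (henqUnique : ∀ (i j : Fin h.m) (x : ℕ),
      h.op i = QueueOp.enq x → h.op j = QueueOp.enq x → i = j)
    (i j : Fin h.m) (x : ℕ) (hij : i ≠ j)
    (hi : h.out i = some (QueueRes.val x)) (hj : h.out j = some (QueueRes.val x)) :
    h.concurrent i j := by
  obtain ⟨L⟩ := hA h hmem
  exact ⟨L.not_precedes_of_out_eq_val henqUnique hi hj,
    L.not_precedes_of_out_eq_val henqUnique hj hi⟩
end

section
/- The algorithm SetSeqQueue is a non-blocking set-linearizable implementation of the set-concurrent queue with multiplicity, using only read/write base objects (registers and a read/write wait-free linearizable counter); moreover its Enq operation is wait-free. -/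
/-- Contents of an entry of `Items`: ⊥ (never written), ⊤ (taken), or an item. -/
inductive Cell
  | bot
  | mark
  | val (x : ℕ)
  deriving DecidableEq

/-- Local control states of a process executing the algorithm SetSeqQueue.
Rows of `Items` are indexed from 1 and columns from 1 to `n` (the column of
process `pᵢ` is `i + 1` for `i : Fin n`). -/
inductive PS
  | idle
  | enq1 (x : ℕ)               -- Enq(x): about to read the counter `Tail`
  | enq2 (x : ℕ) (tail : ℕ)    -- read `tail`: about to increment `Tail`
  | enq3 (x : ℕ) (tail : ℕ)    -- about to write x into `Items[tail][i]`
  | deqReadTail (tk' : ℕ)      -- Deq(): beginning of a while iteration, about to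
                                -- read `Tail` (`tk'` = taken count of previous scan)
  | deqScan (tk' tk tl r s : ℕ) -- about to read `Items[r][s]`
  | deqWrite (tk' tk tl r s : ℕ) (v : Cell) -- read non-⊥ value v, about to write ⊤
  | deqCheck (tk' tk : ℕ)      -- finished a scan: compare taken counts
  | done (res : QueueRes)       -- computed result, about to respond
  deriving DecidableEq

/-- A record of a completed operation. -/
structure LogEntry (n : ℕ) where
  proc : Fin n
  op : QueueOp
  res : QueueRes
  invT : ℕ
  retT : ℕ

/-- A configuration of the system running SetSeqQueue. -/
structure Config (n : ℕ) where
  tail : ℕ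
  items : ℕ → ℕ → Cell
  proc : Fin n → PS
  pend : Fin n → Option (QueueOp × ℕ)
  log : List (LogEntry n)
  time : ℕ

/-- The initial configuration: `Tail = 1`, all entries of `Items` equal ⊥,
all processes idle. -/
def initConfig (n : ℕ) : Config n :=
  { tail := 1
    items := fun _ _ => Cell.bot
    proc := fun _ => PS.idle
    pend := fun _ => none
    log := []
    time := 0 }

/-- One atomic step of process `i` in the algorithm SetSeqQueue. -/
inductive Step {n : ℕ} : Config n → Fin n → Config n → Prop
  | invEnq (c : Config n) (i : Fin n) (x : ℕ)
      (h : c.proc i = PS.idle) (hp : c.pend i = none) :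
      Step c i { c with proc := Function.update c.proc i (PS.enq1 x),
                        pend := Function.update c.pend i (some (QueueOp.enq x, c.time)),
                        time := c.time + 1 }
  | invDeq (c : Config n) (i : Fin n)
      (h : c.proc i = PS.idle) (hp : c.pend i = none) :
      Step c i { c with proc := Function.update c.proc i (PS.deqReadTail 0),
                        pend := Function.update c.pend i (some (QueueOp.deq, c.time)),
                        time := c.time + 1 }
  | enqReadTail (c : Config n) (i : Fin n) (x : ℕ)
      (h : c.proc i = PS.enq1 x) :
      Step c i { c with proc := Function.update c.proc i (PS.enq2 x c.tail),
                        time := c.time + 1 }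
  | enqIncTail (c : Config n) (i : Fin n) (x t : ℕ)
      (h : c.proc i = PS.enq2 x t) :
      Step c i { c with tail := c.tail + 1,
                        proc := Function.update c.proc i (PS.enq3 x t),
                        time := c.time + 1 }
  | enqWrite (c : Config n) (i : Fin n) (x t : ℕ)
      (h : c.proc i = PS.enq3 x t) :
      Step c i { c with items := fun r s =>
                          if r = t ∧ s = (i : ℕ) + 1 then Cell.val x else c.items r s,
                        proc := Function.update c.proc i (PS.done QueueRes.ok),
                        time := c.time + 1 }
  | deqReadTail_pos (c : Config n) (i : Fin n) (tk' : ℕ)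
      (h : c.proc i = PS.deqReadTail tk') (ht : 2 ≤ c.tail) :
      Step c i { c with proc := Function.update c.proc i (PS.deqScan tk' 0 (c.tail - 1) 1 1),
                        time := c.time + 1 }
  | deqReadTail_zero (c : Config n) (i : Fin n) (tk' : ℕ)
      (h : c.proc i = PS.deqReadTail tk') (ht : c.tail ≤ 1) :
      Step c i { c with proc := Function.update c.proc i (PS.deqCheck tk' 0),
                        time := c.time + 1 }
  | deqRead_bot_col (c : Config n) (i : Fin n) (tk' tk tl r s : ℕ)
      (h : c.proc i = PS.deqScan tk' tk tl r s)
      (hx : c.items r s = Cell.bot) (hs : s < n) :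
      Step c i { c with proc := Function.update c.proc i (PS.deqScan tk' tk tl r (s + 1)),
                        time := c.time + 1 }
  | deqRead_bot_row (c : Config n) (i : Fin n) (tk' tk tl r s : ℕ)
      (h : c.proc i = PS.deqScan tk' tk tl r s)
      (hx : c.items r s = Cell.bot) (hs : n ≤ s) (hr : r < tl) :
      Step c i { c with proc := Function.update c.proc i (PS.deqScan tk' tk tl (r + 1) 1),
                        time := c.time + 1 }
  | deqRead_bot_end (c : Config n) (i : Fin n) (tk' tk tl r s : ℕ)
      (h : c.proc i = PS.deqScan tk' tk tl r s)
      (hx : c.items r s = Cell.bot) (hs : n ≤ s) (hr : tl ≤ r) :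
      Step c i { c with proc := Function.update c.proc i (PS.deqCheck tk' tk),
                        time := c.time + 1 }
  | deqRead_nonbot (c : Config n) (i : Fin n) (tk' tk tl r s : ℕ) (v : Cell)
      (h : c.proc i = PS.deqScan tk' tk tl r s)
      (hx : c.items r s = v) (hv : v ≠ Cell.bot) :
      Step c i { c with proc := Function.update c.proc i (PS.deqWrite tk' tk tl r s v),
                        time := c.time + 1 }
  | deqWrite_val (c : Config n) (i : Fin n) (tk' tk tl r s x : ℕ)
      (h : c.proc i = PS.deqWrite tk' tk tl r s (Cell.val x)) :
      Step c i { c with items := fun r' s' =>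
                          if r' = r ∧ s' = s then Cell.mark else c.items r' s',
                        proc := Function.update c.proc i (PS.done (QueueRes.val x)),
                        time := c.time + 1 }
  | deqWrite_mark_col (c : Config n) (i : Fin n) (tk' tk tl r s : ℕ)
      (h : c.proc i = PS.deqWrite tk' tk tl r s Cell.mark) (hs : s < n) :
      Step c i { c with items := fun r' s' =>
                          if r' = r ∧ s' = s then Cell.mark else c.items r' s',
                        proc := Function.update c.proc i (PS.deqScan tk' (tk + 1) tl r (s + 1)),
                        time := c.time + 1 }
  | deqWrite_mark_row (c : Config n) (i : Fin n) (tk' tk tl r s : ℕ)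
      (h : c.proc i = PS.deqWrite tk' tk tl r s Cell.mark) (hs : n ≤ s) (hr : r < tl) :
      Step c i { c with items := fun r' s' =>
                          if r' = r ∧ s' = s then Cell.mark else c.items r' s',
                        proc := Function.update c.proc i (PS.deqScan tk' (tk + 1) tl (r + 1) 1),
                        time := c.time + 1 }
  | deqWrite_mark_end (c : Config n) (i : Fin n) (tk' tk tl r s : ℕ)
      (h : c.proc i = PS.deqWrite tk' tk tl r s Cell.mark) (hs : n ≤ s) (hr : tl ≤ r) :
      Step c i { c with items := fun r' s' =>
                          if r' = r ∧ s' = s then Cell.mark else c.items r' s',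
                        proc := Function.update c.proc i (PS.deqCheck tk' (tk + 1)),
                        time := c.time + 1 }
  | deqCheck_eq (c : Config n) (i : Fin n) (tk : ℕ)
      (h : c.proc i = PS.deqCheck tk tk) :
      Step c i { c with proc := Function.update c.proc i (PS.done QueueRes.empty),
                        time := c.time + 1 }
  | deqCheck_ne (c : Config n) (i : Fin n) (tk' tk : ℕ)
      (h : c.proc i = PS.deqCheck tk' tk) (hne : tk ≠ tk') :
      Step c i { c with proc := Function.update c.proc i (PS.deqReadTail tk),
                        time := c.time + 1 }
  | respond (c : Config n) (i : Fin n) (res : QueueRes) (op : QueueOp) (t0 : ℕ)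
      (h : c.proc i = PS.done res) (hp : c.pend i = some (op, t0)) :
      Step c i { c with proc := Function.update c.proc i PS.idle,
                        pend := Function.update c.pend i none,
                        log := c.log ++ [⟨i, op, res, t0, c.time⟩],
                        time := c.time + 1 }

/-- An (infinite) execution of SetSeqQueue. -/
def Run {n : ℕ} (c : ℕ → Config n) (sched : ℕ → Fin n) : Prop :=
  c 0 = initConfig n ∧ ∀ k, Step (c k) (sched k) (c (k + 1))

/-- The pending operations of a configuration. -/
def pendingList {n : ℕ} (cfg : Config n) : List (QueueOp × ℕ) :=
  (List.finRange n).filterMap cfg.pend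

/-- The history of a configuration: its completed operations (from the log)
followed by its pending operations. -/
def historyAt {n : ℕ} (cfg : Config n) : ConcHistory QueueOp QueueRes where
  m := cfg.log.length + (pendingList cfg).length
  op := fun k =>
    if hk : (k : ℕ) < cfg.log.length then (cfg.log.get ⟨k, hk⟩).op
    else ((pendingList cfg).getD ((k : ℕ) - cfg.log.length) (QueueOp.deq, 0)).1
  inv := fun k =>
    if hk : (k : ℕ) < cfg.log.length then (cfg.log.get ⟨k, hk⟩).invT
    else ((pendingList cfg).getD ((k : ℕ) - cfg.log.length) (QueueOp.deq, 0)).2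
  ret := fun k =>
    if hk : (k : ℕ) < cfg.log.length then some (cfg.log.get ⟨k, hk⟩).retT else none
  out := fun k =>
    if hk : (k : ℕ) < cfg.log.length then some (cfg.log.get ⟨k, hk⟩).res else none

section

open Finset

/-- `c'` may occur after `c` in an execution: `Tail` never decreases and every entry of
`Items` only moves from ⊥ to an item and from an item to ⊤. -/
structure Later {n : ℕ} (c c' : Config n) : Prop where
  tail : c.tail ≤ c'.tail
  val : ∀ r s x, c.items r s = Cell.val x →
    c'.items r s = Cell.val x ∨ c'.items r s = Cell.mark
  mark : ∀ r s, c.items r s = Cell.mark → c'.items r s = Cell.mark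

theorem Later.refl {n : ℕ} (c : Config n) : Later c c :=
  ⟨le_rfl, fun _ _ _ h => Or.inl h, fun _ _ h => h⟩

theorem Later.trans {n : ℕ} {a b c : Config n} (h : Later a b) (h' : Later b c) :
    Later a c where
  tail := h.tail.trans h'.tail
  val := fun r s x hx => by
    rcases h.val r s x hx with h1 | h1
    · exact h'.val r s x h1
    · exact Or.inr (h'.mark r s h1)
  mark := fun r s hx => h'.mark r s (h.mark r s hx)

theorem Later.bot {n : ℕ} {c c' : Config n} (h : Later c c') {r s : ℕ}
    (hb : c'.items r s = Cell.bot) : c.items r s = Cell.bot := by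
  cases hc : c.items r s with
  | bot => rfl
  | mark => have := h.mark r s hc; simp_all
  | val x => have := h.val r s x hc; simp_all

/-- Invariant relating the shared memory to the local states of the processes. -/
structure MemInv {n : ℕ} (c : Config n) : Prop where
  one_le_tail : 1 ≤ c.tail
  range : ∀ r s, c.items r s ≠ Cell.bot → 1 ≤ r ∧ r < c.tail ∧ 1 ≤ s ∧ s ≤ n
  enq2 : ∀ i x t, c.proc i = PS.enq2 x t →
    1 ≤ t ∧ t ≤ c.tail ∧ ∀ r, t ≤ r → c.items r (i + 1) = Cell.bot
  enq3 : ∀ i x t, c.proc i = PS.enq3 x t →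
    1 ≤ t ∧ t < c.tail ∧ ∀ r, t ≤ r → c.items r (i + 1) = Cell.bot
  write : ∀ i tk' tk tl r s v, c.proc i = PS.deqWrite tk' tk tl r s v →
    v ≠ Cell.bot ∧ c.items r s ≠ Cell.bot ∧ (v = Cell.mark → c.items r s = Cell.mark)

theorem memInv_init (n : ℕ) : MemInv (initConfig n) := by
  constructor <;> simp [initConfig]

/-- The possible effects of a step on an entry of `Items`. -/
theorem Step.items {n : ℕ} {c c' : Config n} {i : Fin n} (h : Step c i c') (hc : MemInv c)
    (r s : ℕ) :
    c'.items r s = c.items r s ∨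
    (c.items r s = Cell.bot ∧ ∃ x, c.proc i = PS.enq3 x r ∧ s = i + 1 ∧
      c'.items r s = Cell.val x ∧ c'.proc i = PS.done QueueRes.ok) ∨
    (∃ y, c.items r s = Cell.val y ∧ c'.items r s = Cell.mark ∧
      ∃ tk' tk tl x, c.proc i = PS.deqWrite tk' tk tl r s (Cell.val x) ∧
        c'.proc i = PS.done (QueueRes.val x)) := by
  have hw := hc.write i
  have h3 := hc.enq3 i
  cases h <;> try (left; rfl)
  case enqWrite x t h =>
    by_cases hrs : r = t ∧ s = i + 1
    · obtain ⟨rfl, rfl⟩ := hrs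
      right; left
      simp [h, (h3 _ _ h).2.2 r le_rfl]
    · left; simp [hrs]
  case deqWrite_val tk' tk tl r0 s0 x h =>
    by_cases hrs : r = r0 ∧ s = s0
    · obtain ⟨rfl, rfl⟩ := hrs
      have h0 := (hw _ _ _ _ _ _ h).2.1
      cases hx : c.items r s with
      | bot => exact absurd hx h0
      | mark => left; simp
      | val y => right; right; simp [h]
    · left; simp [hrs]
  all_goals
    have hm := (hw _ _ _ _ _ _ ‹c.proc i = PS.deqWrite _ _ _ _ _ Cell.mark›).2.2 rfl
    left
    dsimp only
    split_ifs with hrs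
    · rw [hrs.1, hrs.2, hm]
    · rfl

theorem Step.tail_le {n : ℕ} {c c' : Config n} {i : Fin n} (h : Step c i c') :
    c.tail ≤ c'.tail := by
  cases h <;> simp

theorem Step.later {n : ℕ} {c c' : Config n} {i : Fin n} (h : Step c i c') (hc : MemInv c) :
    Later c c' where
  tail := h.tail_le
  val := fun r s x hx => by rcases Step.items h hc r s with h1 | h1 | h1 <;> grind
  mark := fun r s hx => by rcases Step.items h hc r s with h1 | h1 | h1 <;> grind

theorem Step.proc_ne {n : ℕ} {c c' : Config n} {i j : Fin n} (h : Step c i c') (hj : j ≠ i) :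
    c'.proc j = c.proc j := by
  cases h <;> simp [Function.update_of_ne hj]

theorem Step.pend_ne {n : ℕ} {c c' : Config n} {i j : Fin n} (h : Step c i c') (hj : j ≠ i) :
    c'.pend j = c.pend j := by
  cases h <;> simp [Function.update_of_ne hj]

theorem Step.time_eq {n : ℕ} {c c' : Config n} {i : Fin n} (h : Step c i c') :
    c'.time = c.time + 1 := by
  cases h <;> rfl

theorem Step.memInv {n : ℕ} {c c' : Config n} {i : Fin n} (h : Step c i c') (hc : MemInv c) :
    MemInv c' := by
  have hl := Step.later h hc
  have hbot : ∀ (j : Fin n) r, j ≠ i → c.items r (j + 1) = Cell.bot →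
      c'.items r (j + 1) = Cell.bot := by
    intro j r hj hb
    have : (j : ℕ) ≠ i := fun h => hj (Fin.ext h)
    rcases Step.items h hc r (j + 1) with h1 | h1 | h1 <;> grind
  constructor
  · exact hc.one_le_tail.trans hl.tail
  · intro r s hb
    have := hc.range r s
    have := hl.tail
    have h3 := hc.enq3 i
    rcases Step.items h hc r s with h1 | ⟨_, x, h1, h2, _⟩ | h1
    · grind
    · have := h3 _ _ h1
      have := i.2
      omega
    · grind
  · intro j x t hj
    by_cases hji : j = i
    · subst hji
      have h1 := hc.one_le_tail
      have h2 := hc.range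
      cases h <;> simp_all
      grind
    · rw [Step.proc_ne h hji] at hj
      obtain ⟨h1, h2, h3⟩ := hc.enq2 j x t hj
      exact ⟨h1, h2.trans hl.tail, fun r hr => hbot j r hji (h3 r hr)⟩
  · intro j x t hj
    by_cases hji : j = i
    · subst hji
      have h2 := hc.enq2 j
      cases h <;> simp_all
    · rw [Step.proc_ne h hji] at hj
      obtain ⟨h1, h2, h3⟩ := hc.enq3 j x t hj
      exact ⟨h1, h2.trans_le hl.tail, fun r hr => hbot j r hji (h3 r hr)⟩
  · intro j tk' tk tl r s v hj
    by_cases hji : j = i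
    · subst hji
      cases h <;> simp_all
    · rw [Step.proc_ne h hji] at hj
      obtain ⟨h1, h2, h3⟩ := hc.write j _ _ _ _ _ _ hj
      exact ⟨h1, fun hb => h2 (hl.bot hb), fun hv => hl.mark _ _ (h3 hv)⟩

theorem Run.memInv {n : ℕ} {c : ℕ → Config n} {sched : ℕ → Fin n} (h : Run c sched) (k : ℕ) :
    MemInv (c k) := by
  induction k with
  | zero => rw [h.1]; exact memInv_init n
  | succ k ih => exact Step.memInv (h.2 k) ih

theorem Run.later {n : ℕ} {c : ℕ → Config n} {sched : ℕ → Fin n} (h : Run c sched) {j k : ℕ}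
    (hjk : j ≤ k) : Later (c j) (c k) := by
  induction k, hjk using Nat.le_induction with
  | base => exact Later.refl _
  | succ k _ ih => exact ih.trans (Step.later (h.2 k) (Run.memInv h k))

theorem Run.time_eq {n : ℕ} {c : ℕ → Config n} {sched : ℕ → Fin n} (h : Run c sched) (k : ℕ) :
    (c k).time = k := by
  induction k with
  | zero => rw [h.1]; rfl
  | succ k ih => rw [Step.time_eq (h.2 k), ih]

/-- The entries of `Items` that a scan visits strictly before entry `(r, s)`. -/
def scanned (n r s : ℕ) : Finset (ℕ × ℕ) :=
  (Icc 1 r ×ˢ Icc 1 n).filter (fun p => p.1 < r ∨ p.2 < s)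

theorem mem_scanned {n r s : ℕ} {p : ℕ × ℕ} :
    p ∈ scanned n r s ↔ 1 ≤ p.1 ∧ 1 ≤ p.2 ∧ p.2 ≤ n ∧ (p.1 < r ∨ p.1 = r ∧ p.2 < s) := by
  simp only [scanned, mem_filter, mem_product, mem_Icc]
  omega

theorem scanned_col {n r s : ℕ} (hr : 1 ≤ r) (hs : 1 ≤ s) (hn : s ≤ n) :
    scanned n r (s + 1) = insert (r, s) (scanned n r s) := by
  ext ⟨a, b⟩
  simp only [mem_insert, mem_scanned, Prod.mk.injEq]
  omega

theorem scanned_row {n r s : ℕ} (hs : n < s) : scanned n (r + 1) 1 = scanned n r s := by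
  ext ⟨a, b⟩
  simp only [mem_scanned]
  omega

theorem scanned_mono {n r r' s : ℕ} (h : r ≤ r') : scanned n r s ⊆ scanned n r' s := by
  rintro ⟨a, b⟩
  simp only [mem_scanned]
  omega

/-- The number of entries in `P` containing ⊤. -/
def marks {n : ℕ} (c : Config n) (P : Finset (ℕ × ℕ)) : ℕ :=
  (P.filter (fun p => c.items p.1 p.2 = Cell.mark)).card

theorem marks_mono {n : ℕ} {c c' : Config n} (h : Later c c') {P P' : Finset (ℕ × ℕ)}
    (hP : P ⊆ P') : marks c P ≤ marks c' P' := by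
  apply card_le_card
  intro p hp
  simp only [mem_filter] at hp ⊢
  exact ⟨hP hp.1, h.mark _ _ hp.2⟩

/-- What a dequeue knows after reading the entries in `P` and counting `tk` of them as taken,
when it read `Tail` in configuration `c₀` and the current configuration is `c`. -/
structure Seen {n : ℕ} (c₀ c : Config n) (P : Finset (ℕ × ℕ)) (tk : ℕ) : Prop where
  lower : (P.filter (fun p => c₀.items p.1 p.2 ≠ Cell.bot)).card ≤ tk
  upper : tk ≤ marks c P
  marked : ∀ p ∈ P, c₀.items p.1 p.2 ≠ Cell.bot → c.items p.1 p.2 = Cell.mark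

theorem Seen.empty {n : ℕ} (c₀ c : Config n) : Seen c₀ c ∅ 0 := by
  constructor <;> simp

theorem Seen.mono {n : ℕ} {c₀ c c' : Config n} {P : Finset (ℕ × ℕ)} {tk : ℕ}
    (h : Seen c₀ c P tk) (hl : Later c c') : Seen c₀ c' P tk :=
  ⟨h.lower, h.upper.trans (marks_mono hl Subset.rfl), fun p hp hb => hl.mark _ _ (h.marked p hp hb)⟩

theorem Seen.insert_bot {n : ℕ} {c₀ c : Config n} {P : Finset (ℕ × ℕ)} {tk r s : ℕ}
    (h : Seen c₀ c P tk) (hb : c₀.items r s = Cell.bot) : Seen c₀ c (insert (r, s) P) tk where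
  lower := by
    rw [filter_insert, if_neg (by simp [hb])]
    exact h.lower
  upper := h.upper.trans (marks_mono (Later.refl c) (subset_insert _ _))
  marked := by
    intro p hp hb'
    rcases mem_insert.1 hp with rfl | hp
    · exact absurd hb hb'
    · exact h.marked p hp hb'

theorem Seen.insert_mark {n : ℕ} {c₀ c : Config n} {P : Finset (ℕ × ℕ)} {tk r s : ℕ}
    (h : Seen c₀ c P tk) (hp : (r, s) ∉ P) (hm : c.items r s = Cell.mark) :
    Seen c₀ c (insert (r, s) P) (tk + 1) where
  lower := by
    have := h.lower
    rw [filter_insert]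
    split_ifs
    · exact (card_insert_le _ _).trans (by omega)
    · omega
  upper := by
    have := h.upper
    unfold marks at *
    rw [filter_insert, if_pos hm, card_insert_of_notMem (by simp [hp])]
    omega
  marked := by
    intro p hp hne
    rcases mem_insert.1 hp with rfl | hp
    · exact hm
    · exact h.marked p hp hne

/-- State of a dequeue about to treat entry `(r, s)`. -/
structure Scan {n : ℕ} (c₀ c : Config n) (tk' tk tl r s : ℕ) : Prop where
  tail : tl + 1 = c₀.tail
  prev : tk' ≤ marks c₀ (scanned n (tl + 1) 1)
  seen : Seen c₀ c (scanned n r s) tk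
  one_le_row : 1 ≤ r
  row_le : r ≤ tl
  one_le_col : 1 ≤ s
  col_le : s ≤ n

theorem Scan.mono {n : ℕ} {c₀ c c' : Config n} {tk' tk tl r s : ℕ}
    (h : Scan c₀ c tk' tk tl r s) (hl : Later c c') : Scan c₀ c' tk' tk tl r s :=
  { h with seen := h.seen.mono hl }

theorem Scan.next_bot {n : ℕ} {c₀ c : Config n} {tk' tk tl r s : ℕ}
    (h : Scan c₀ c tk' tk tl r s) (hb : c₀.items r s = Cell.bot) :
    Seen c₀ c (scanned n r (s + 1)) tk := by
  rw [scanned_col h.one_le_row h.one_le_col h.col_le]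
  exact h.seen.insert_bot hb

theorem Scan.next_mark {n : ℕ} {c₀ c : Config n} {tk' tk tl r s : ℕ}
    (h : Scan c₀ c tk' tk tl r s) (hm : c.items r s = Cell.mark) :
    Seen c₀ c (scanned n r (s + 1)) (tk + 1) := by
  rw [scanned_col h.one_le_row h.one_le_col h.col_le]
  exact h.seen.insert_mark (by simp [mem_scanned]) hm

theorem Scan.col {n : ℕ} {c₀ c : Config n} {tk' tk tk₂ tl r s : ℕ}
    (h : Scan c₀ c tk' tk tl r s) (hs : s < n) (hn : Seen c₀ c (scanned n r (s + 1)) tk₂) :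
    Scan c₀ c tk' tk₂ tl r (s + 1) :=
  { h with seen := hn, one_le_col := by omega, col_le := hs }

theorem Scan.row {n : ℕ} {c₀ c : Config n} {tk' tk tk₂ tl r s : ℕ}
    (h : Scan c₀ c tk' tk tl r s) (hs : n ≤ s) (hr : r < tl)
    (hn : Seen c₀ c (scanned n r (s + 1)) tk₂) :
    Scan c₀ c tk' tk₂ tl (r + 1) 1 :=
  { h with
    seen := by rw [scanned_row (s := s + 1) (by omega)]; exact hn
    one_le_row := by omega
    row_le := hr
    one_le_col := le_rfl
    col_le := h.one_le_col.trans h.col_le }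

/-- No entry of `Items` contains an item. -/
def NoItem {n : ℕ} (c : Config n) : Prop := ∀ r s x, c.items r s ≠ Cell.val x

theorem Seen.check {n : ℕ} {c₀ c : Config n} {tk' tk : ℕ}
    (h : Seen c₀ c (scanned n c₀.tail 1) tk) (hl : Later c₀ c) (hc : MemInv c₀)
    (hp : tk' ≤ marks c₀ (scanned n c₀.tail 1)) :
    tk' ≤ tk ∧ tk ≤ marks c (scanned n c.tail 1) ∧ (tk = tk' → NoItem c₀) := by
  have hsub : (scanned n c₀.tail 1).filter (fun p => c₀.items p.1 p.2 = Cell.mark) ⊆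
      (scanned n c₀.tail 1).filter (fun p => c₀.items p.1 p.2 ≠ Cell.bot) := by
    intro p hp
    simp only [mem_filter] at hp ⊢
    simp [hp]
  have hle := card_le_card hsub
  have hlow := h.lower
  unfold marks at hp
  refine ⟨by omega, h.upper.trans (marks_mono (Later.refl c) (scanned_mono hl.tail)), ?_⟩
  intro htk r s x hx
  have heq := eq_of_subset_of_card_le hsub (by omega)
  have hr := hc.range r s (by simp [hx])
  have hmem : (r, s) ∈ (scanned n c₀.tail 1).filter
      (fun p => c₀.items p.1 p.2 ≠ Cell.bot) := by
    simp only [mem_filter, mem_scanned]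
    refine ⟨by omega, by simp [hx]⟩
  rw [← heq] at hmem
  simp [hx] at hmem

theorem Scan.check {n : ℕ} {c₀ c : Config n} {tk' tk tk₂ tl r s : ℕ}
    (h : Scan c₀ c tk' tk tl r s) (hs : n ≤ s) (hr : tl ≤ r)
    (hn : Seen c₀ c (scanned n r (s + 1)) tk₂) (hl : Later c₀ c) (hc : MemInv c₀) :
    tk' ≤ tk₂ ∧ tk₂ ≤ marks c (scanned n c.tail 1) ∧ (tk₂ = tk' → NoItem c₀) := by
  have hrt : r = tl := le_antisymm h.row_le hr
  subst hrt
  rw [← scanned_row (by omega), h.tail] at hn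
  exact hn.check hl hc (h.tail ▸ h.prev)

/-- What process `i`, whose local state in the current configuration `cur` is reached after `k`
steps of the execution `c`, knows about the past of its current operation. -/
def LocalInv {n : ℕ} (c : ℕ → Config n) (k : ℕ) (cur : Config n) (i : Fin n) : Prop :=
  match cur.proc i with
  | PS.idle => cur.pend i = none
  | PS.enq1 x => ∃ t₀ < k, cur.pend i = some (QueueOp.enq x, t₀)
  | PS.enq2 x t => ∃ t₀ u, cur.pend i = some (QueueOp.enq x, t₀) ∧ t₀ < u ∧ u < k ∧ (c u).tail = t
  | PS.enq3 x t => ∃ t₀ u, cur.pend i = some (QueueOp.enq x, t₀) ∧ t₀ < u ∧ u < k ∧ (c u).tail = t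
  | PS.deqReadTail tk' => ∃ t₀ < k, cur.pend i = some (QueueOp.deq, t₀) ∧
      tk' ≤ marks cur (scanned n cur.tail 1)
  | PS.deqScan tk' tk tl r s => ∃ t₀ τ, cur.pend i = some (QueueOp.deq, t₀) ∧ t₀ < τ ∧ τ < k ∧
      Scan (c τ) cur tk' tk tl r s
  | PS.deqWrite tk' tk tl r s v => ∃ t₀ τ k₀, cur.pend i = some (QueueOp.deq, t₀) ∧ t₀ < τ ∧
      τ < k₀ ∧ k₀ < k ∧ (c k₀).items r s = v ∧ Scan (c τ) cur tk' tk tl r s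
  | PS.deqCheck tk' tk => ∃ t₀ τ, cur.pend i = some (QueueOp.deq, t₀) ∧ t₀ < τ ∧ τ < k ∧
      tk' ≤ tk ∧ tk ≤ marks cur (scanned n cur.tail 1) ∧ (tk = tk' → NoItem (c τ))
  | PS.done _ => ∃ op, ∃ t₀ < k, cur.pend i = some (op, t₀)

theorem LocalInv.other {n : ℕ} {c : ℕ → Config n} {k : ℕ} {cur cur' : Config n} {i j : Fin n}
    (h : LocalInv c k cur j) (hst : Step cur i cur') (hm : MemInv cur) (hj : j ≠ i) :
    LocalInv c (k + 1) cur' j := by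
  have hl := Step.later hst hm
  have hmk := marks_mono hl (scanned_mono (n := n) (s := 1) hl.tail)
  unfold LocalInv at *
  rw [Step.proc_ne hst hj, Step.pend_ne hst hj]
  cases hp : cur.proc j <;> simp only [hp] at h ⊢
  case idle => exact h
  case enq1 x =>
    obtain ⟨t₀, h1, h2⟩ := h
    exact ⟨t₀, by omega, h2⟩
  case enq2 x t =>
    obtain ⟨t₀, u, h1, h2, h3, h4⟩ := h
    exact ⟨t₀, u, h1, h2, by omega, h4⟩
  case enq3 x t =>
    obtain ⟨t₀, u, h1, h2, h3, h4⟩ := h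
    exact ⟨t₀, u, h1, h2, by omega, h4⟩
  case deqReadTail tk' =>
    obtain ⟨t₀, h1, h2, h3⟩ := h
    exact ⟨t₀, by omega, h2, h3.trans hmk⟩
  case deqScan tk' tk tl r s =>
    obtain ⟨t₀, τ, h1, h2, h3, h4⟩ := h
    exact ⟨t₀, τ, h1, h2, by omega, h4.mono hl⟩
  case deqWrite tk' tk tl r s v =>
    obtain ⟨t₀, τ, k₀, h1, h2, h3, h4, h5, h6⟩ := h
    exact ⟨t₀, τ, k₀, h1, h2, h3, by omega, h5, h6.mono hl⟩
  case deqCheck tk' tk =>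
    obtain ⟨t₀, τ, h1, h2, h3, h4, h5, h6⟩ := h
    exact ⟨t₀, τ, h1, h2, by omega, h4, h5.trans hmk, h6⟩
  case done r =>
    obtain ⟨op, t₀, h1, h2⟩ := h
    exact ⟨op, t₀, by omega, h2⟩

theorem LocalInv.self {n : ℕ} {c : ℕ → Config n} {k : ℕ} {cur' : Config n} {i : Fin n}
    (h : LocalInv c k (c k) i) (hst : Step (c k) i cur')
    (hpast : ∀ τ ≤ k, Later (c τ) (c k) ∧ MemInv (c τ)) (hk : (c k).time = k) :
    LocalInv c (k + 1) cur' i := by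
  have hl := Step.later hst (hpast k le_rfl).2
  have hmk := marks_mono hl (scanned_mono (n := n) (s := 1) hl.tail)
  have hm := (hpast k le_rfl).2
  have hm' := Step.memInv hst hm
  have hn := i.2
  unfold LocalInv at *
  cases hst
  case invEnq x h1 h2 => simp [hk]
  case invDeq h1 h2 => simp [hk]
  case enqReadTail x h1 => simp_all; grind
  case enqIncTail x t h1 =>
    simp only [h1] at h
    obtain ⟨t₀, u, hp, h2, h3, h4⟩ := h
    simp only [Function.update_self]
    exact ⟨t₀, u, hp, h2, by omega, h4⟩
  case enqWrite x t h1 => simp_all; grind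
  case deqReadTail_pos tk' h1 ht =>
    simp only [h1] at h
    obtain ⟨t₀, h0, hp, h3⟩ := h
    simp only [Function.update_self]
    have ht' : (c k).tail - 1 + 1 = (c k).tail := by omega
    refine ⟨t₀, k, hp, h0, by omega, ht', by rw [ht']; exact h3, ?_, le_rfl, by omega, le_rfl,
      by omega⟩
    have : scanned n 1 1 = ∅ := by
      ext p
      simp only [mem_scanned, notMem_empty, iff_false]
      omega
    rw [this]
    exact Seen.empty _ _
  case deqReadTail_zero tk' h1 ht =>
    simp only [h1] at h
    obtain ⟨t₀, h0, hp, h3⟩ := h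
    simp only [Function.update_self]
    have hs : scanned n (c k).tail 1 = ∅ := by
      ext p
      simp only [mem_scanned, notMem_empty, iff_false]
      omega
    have := Seen.check (hs ▸ Seen.empty (c k) (c k)) (Later.refl _) hm h3
    exact ⟨t₀, k, hp, h0, by omega, this⟩
  case deqRead_bot_col tk' tk tl r s h1 hx hs =>
    simp only [h1] at h
    obtain ⟨t₀, τ, hp, h0, h2, hsc⟩ := h
    simp only [Function.update_self]
    have hb := (hpast τ h2.le).1.bot hx
    exact ⟨t₀, τ, hp, h0, by omega, (hsc.col hs (hsc.next_bot hb)).mono hl⟩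
  case deqRead_bot_row tk' tk tl r s h1 hx hs hr =>
    simp only [h1] at h
    obtain ⟨t₀, τ, hp, h0, h2, hsc⟩ := h
    simp only [Function.update_self]
    have hb := (hpast τ h2.le).1.bot hx
    exact ⟨t₀, τ, hp, h0, by omega, (hsc.row hs hr (hsc.next_bot hb)).mono hl⟩
  case deqRead_bot_end tk' tk tl r s h1 hx hs hr =>
    simp only [h1] at h
    obtain ⟨t₀, τ, hp, h0, h2, hsc⟩ := h
    simp only [Function.update_self]
    have hb := (hpast τ h2.le).1.bot hx
    exact ⟨t₀, τ, hp, h0, by omega, hsc.check hs hr (hsc.next_bot hb) (hpast τ h2.le).1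
      (hpast τ h2.le).2⟩
  case deqRead_nonbot tk' tk tl r s v h1 hx hv =>
    simp only [h1] at h
    obtain ⟨t₀, τ, hp, h0, h2, hsc⟩ := h
    simp only [Function.update_self]
    exact ⟨t₀, τ, k, hp, h0, h2, by omega, hx, hsc.mono hl⟩
  case deqWrite_val tk' tk tl r s x h1 =>
    simp only [h1] at h
    obtain ⟨t₀, τ, k₀, hp, h0, h2, h3, h4, hsc⟩ := h
    simp only [Function.update_self]
    exact ⟨_, t₀, by omega, hp⟩
  case deqWrite_mark_col tk' tk tl r s h1 hs =>
    simp only [h1] at h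
    obtain ⟨t₀, τ, k₀, hp, h0, h2, h3, h4, hsc⟩ := h
    simp only [Function.update_self]
    have hb := (hm.write _ _ _ _ _ _ _ h1).2.2 rfl
    exact ⟨t₀, τ, hp, h0, by omega, (hsc.col hs (hsc.next_mark hb)).mono hl⟩
  case deqWrite_mark_row tk' tk tl r s h1 hs hr =>
    simp only [h1] at h
    obtain ⟨t₀, τ, k₀, hp, h0, h2, h3, h4, hsc⟩ := h
    simp only [Function.update_self]
    have hb := (hm.write _ _ _ _ _ _ _ h1).2.2 rfl
    exact ⟨t₀, τ, hp, h0, by omega, (hsc.row hs hr (hsc.next_mark hb)).mono hl⟩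
  case deqWrite_mark_end tk' tk tl r s h1 hs hr =>
    simp only [h1] at h
    obtain ⟨t₀, τ, k₀, hp, h0, h2, h3, h4, hsc⟩ := h
    simp only [Function.update_self]
    have hb := (hm.write _ _ _ _ _ _ _ h1).2.2 rfl
    have hτ := hpast τ (by omega)
    obtain ⟨h5, h6, h7⟩ := hsc.check hs hr (hsc.next_mark hb) hτ.1 hτ.2
    exact ⟨t₀, τ, hp, h0, by omega, h5, h6.trans hmk, h7⟩
  case deqCheck_eq tk h1 => simp_all; grind
  case deqCheck_ne tk' tk h1 hne =>
    simp only [h1] at h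
    obtain ⟨t₀, τ, hp, h0, h2, h3, h4, h5⟩ := h
    simp only [Function.update_self]
    exact ⟨t₀, by omega, hp, h4⟩
  case respond res op t0 h1 hp => simp

theorem Run.localInv {n : ℕ} {c : ℕ → Config n} {sched : ℕ → Fin n} (h : Run c sched) (k : ℕ)
    (i : Fin n) : LocalInv c k (c k) i := by
  induction k with
  | zero => rw [h.1]; simp [LocalInv, initConfig]
  | succ k ih =>
    by_cases hi : i = sched k
    · subst hi
      exact ih.self (h.2 k) (fun τ hτ => ⟨Run.later h hτ, Run.memInv h τ⟩) (Run.time_eq h k)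
    · exact ih.other (h.2 k) (Run.memInv h k) hi

/-- The number of own steps before the response of an enqueue. -/
def enqSteps : PS → ℕ
  | PS.enq1 _ => 4
  | PS.enq2 _ _ => 3
  | PS.enq3 _ _ => 2
  | _ => 1

theorem Run.enq_step {n : ℕ} {c : ℕ → Config n} {sched : ℕ → Fin n} (h : Run c sched) {k : ℕ}
    {i : Fin n} {x t : ℕ} (hp : (c k).pend i = some (QueueOp.enq x, t)) (hi : sched k = i) :
    (c (k + 1)).pend i = none ∨
      (c (k + 1)).pend i = some (QueueOp.enq x, t) ∧
        enqSteps ((c (k + 1)).proc i) < enqSteps ((c k).proc i) := by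
  have hl := Run.localInv h k i
  have hst := h.2 k
  subst hi
  generalize c (k + 1) = c' at *
  unfold LocalInv at hl
  cases hst <;> simp_all [enqSteps]

theorem Run.enq_completes {n : ℕ} {c : ℕ → Config n} {sched : ℕ → Fin n} (h : Run c sched)
    {i : Fin n} (hi : ∀ k, ∃ k' ≥ k, sched k' = i) {k x t : ℕ}
    (hp : (c k).pend i = some (QueueOp.enq x, t)) : ∃ k' > k, (c k').pend i = none := by
  induction hd : enqSteps ((c k).proc i) using Nat.strong_induction_on generalizing k with
  | _ d ih =>
    classical
    obtain ⟨hk₁, hs⟩ := Nat.find_spec (hi k)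
    have hmin : ∀ j, k ≤ j → j < Nat.find (hi k) → sched j ≠ i := fun j hj hlt he =>
      Nat.find_min (hi k) hlt ⟨hj, he⟩
    set k₁ := Nat.find (hi k)
    have hsame : ∀ j, k ≤ j → j ≤ k₁ →
        (c j).pend i = (c k).pend i ∧ (c j).proc i = (c k).proc i := by
      intro j hj
      induction j, hj using Nat.le_induction with
      | base => simp
      | succ j hj ihj =>
        intro hlt
        have hne : i ≠ sched j := fun he => hmin j hj hlt he.symm
        rw [Step.pend_ne (h.2 j) hne, Step.proc_ne (h.2 j) hne]
        exact ihj (by omega)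
    obtain ⟨h1, h2⟩ := hsame k₁ hk₁ le_rfl
    rcases Run.enq_step h (h1.trans hp) hs with h3 | ⟨h3, h4⟩
    · exact ⟨k₁ + 1, by omega, h3⟩
    · rw [h2, hd] at h4
      obtain ⟨k', hk', hn⟩ := ih _ h4 h3 rfl
      exact ⟨k', by omega, hn⟩

/-- Steps left to a process before it can only execute a dequeue or respond. -/
def setupSteps : PS → ℕ
  | PS.idle => 4
  | PS.enq1 _ => 3
  | PS.enq2 _ _ => 2
  | PS.enq3 _ _ => 1
  | _ => 0

/-- Upper bound on the number of steps left to a dequeue when `Tail` has value at most `T`. -/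
def deqSteps (n T : ℕ) : PS → ℕ
  | PS.deqReadTail tk' => (T * n - tk') * (2 * (T * n) + 4) + (2 * (T * n) + 3)
  | PS.deqScan tk' _ tl r s =>
      (T * n - tk') * (2 * (T * n) + 4) + (2 * ((tl - r) * n + (n - s)) + 3)
  | PS.deqWrite tk' _ tl r s _ =>
      (T * n - tk') * (2 * (T * n) + 4) + (2 * ((tl - r) * n + (n - s)) + 2)
  | PS.deqCheck tk' _ => (T * n - tk') * (2 * (T * n) + 4) + 1
  | _ => 0

theorem Step.setupSteps_le {n : ℕ} {c c' : Config n} {i : Fin n} (h : Step c i c')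
    (hlog : c'.log.length = c.log.length) :
    setupSteps (c'.proc i) < setupSteps (c.proc i) ∨
      (setupSteps (c'.proc i) = setupSteps (c.proc i) ∧ setupSteps (c.proc i) = 0 ∧
        c'.tail = c.tail) := by
  cases h <;> simp_all [setupSteps]

theorem marks_le {n : ℕ} (c : Config n) (T : ℕ) : marks c (scanned n T 1) ≤ T * n := by
  calc marks c (scanned n T 1) ≤ (Icc 1 T ×ˢ Icc 1 n).card :=
        card_le_card ((filter_subset _ _).trans (filter_subset _ _))
    _ = T * n := by simp

theorem Run.deqSteps_lt {n : ℕ} {c : ℕ → Config n} {sched : ℕ → Fin n} (h : Run c sched) {k : ℕ}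
    (hlog : (c (k + 1)).log.length = (c k).log.length)
    (hset : setupSteps ((c k).proc (sched k)) = 0) :
    deqSteps n (c k).tail ((c (k + 1)).proc (sched k)) <
      deqSteps n (c k).tail ((c k).proc (sched k)) := by
  have hl := Run.localInv h k (sched k)
  have hm := marks_le (c k) (c k).tail
  have hn := (sched k).2
  have hst := h.2 k
  generalize c (k + 1) = c' at *
  have hrow : ∀ tl r : ℕ, r < tl → (tl - r) * n = (tl - (r + 1)) * n + n := by
    intro tl r hr
    rw [show tl - r = tl - (r + 1) + 1 by omega, Nat.add_mul, Nat.one_mul]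
  unfold LocalInv at hl
  cases hst
  case deqReadTail_pos tk' h1 ht =>
    simp only [h1, Function.update_self, deqSteps]
    have h1 := hrow (c k).tail 0 (by omega)
    have h2 := hrow (c k).tail 1 (by omega)
    simp only [Nat.sub_zero, zero_add] at h1
    rw [show (c k).tail - 1 - 1 = (c k).tail - (1 + 1) by omega]
    omega
  case deqRead_bot_row tk' tk tl r s h1 hx hs hr =>
    simp only [h1, Function.update_self, deqSteps]
    have := hrow tl r hr
    omega
  case deqWrite_mark_row tk' tk tl r s h1 hs hr =>
    simp only [h1, Function.update_self, deqSteps]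
    have := hrow tl r hr
    omega
  case deqCheck_ne tk' tk h1 hne =>
    simp only [h1] at hl
    obtain ⟨t₀, τ, hp, h0, h2, h3, h4, h5⟩ := hl
    simp only [h1, Function.update_self, deqSteps]
    have : (c k).tail * n - tk' = ((c k).tail * n - tk) + (tk - tk' - 1) + 1 := by omega
    rw [this]
    generalize (c k).tail * n - tk = a
    generalize 2 * ((c k).tail * n) = b
    rw [Nat.add_mul _ 1, Nat.add_mul _ (_ - 1)]
    omega
  all_goals simp_all [setupSteps, deqSteps]
  all_goals omega

/-- A natural-valued sequence that never increases is eventually constant. -/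
theorem eventually_const_of_antitone (f : ℕ → ℕ) (k₀ : ℕ)
    (hf : ∀ k ≥ k₀, f (k + 1) ≤ f k) : ∃ k₁ ≥ k₀, ∀ k ≥ k₁, f (k + 1) = f k := by
  induction hd : f k₀ using Nat.strong_induction_on generalizing k₀ with
  | _ d ih =>
    by_cases hex : ∃ k ≥ k₀, f (k + 1) < f k
    · obtain ⟨k, hk, hlt⟩ := hex
      have hle : f k ≤ f k₀ := by
        clear hlt
        induction k, hk using Nat.le_induction with
        | base => exact le_rfl
        | succ k hk ihk => exact (hf k hk).trans ihk
      obtain ⟨k₁, h1, h2⟩ := ih _ (by omega) (k + 1) (fun j hj => hf j (by omega)) rfl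
      exact ⟨k₁, by omega, h2⟩
    · push Not at hex
      exact ⟨k₀, le_rfl, fun k hk => le_antisymm (hf k hk) (hex k hk)⟩

theorem Step.sum_proc_lt {n : ℕ} {c c' : Config n} {i : Fin n} (h : Step c i c') (f : PS → ℕ)
    (hf : f (c'.proc i) < f (c.proc i)) : ∑ j, f (c'.proc j) < ∑ j, f (c.proc j) := by
  refine sum_lt_sum (fun j _ => ?_) ⟨i, mem_univ i, hf⟩
  by_cases hj : j = i
  · exact hj ▸ hf.le
  · rw [Step.proc_ne h hj]

theorem Step.log_length_le {n : ℕ} {c c' : Config n} {i : Fin n} (h : Step c i c') :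
    c.log.length ≤ c'.log.length := by
  cases h <;> simp

theorem Run.log_unbounded {n : ℕ} {c : ℕ → Config n} {sched : ℕ → Fin n} (h : Run c sched)
    (m : ℕ) : ∃ k, m ≤ (c k).log.length := by
  by_contra! hlt
  obtain ⟨k₁, -, hlog⟩ := eventually_const_of_antitone (fun k => m - (c k).log.length) 0
    (fun k _ => Nat.sub_le_sub_left (Step.log_length_le (h.2 k)) m)
  replace hlog : ∀ k ≥ k₁, (c (k + 1)).log.length = (c k).log.length := by
    intro k hk
    have h1 := hlog k hk
    have h2 := hlt k
    have h3 := hlt (k + 1)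
    omega
  have hdec : ∀ k ≥ k₁,
      ∑ j, setupSteps ((c (k + 1)).proc j) < ∑ j, setupSteps ((c k).proc j) ∨
        (∑ j, setupSteps ((c (k + 1)).proc j) = ∑ j, setupSteps ((c k).proc j) ∧
          setupSteps ((c k).proc (sched k)) = 0 ∧ (c (k + 1)).tail = (c k).tail) := by
    intro k hk
    rcases Step.setupSteps_le (h.2 k) (hlog k hk) with h1 | ⟨h1, h2, h3⟩
    · exact Or.inl (Step.sum_proc_lt (h.2 k) setupSteps h1)
    · refine Or.inr ⟨sum_congr rfl fun j _ => ?_, h2, h3⟩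
      by_cases hj : j = sched k
      · rw [hj, h1]
      · rw [Step.proc_ne (h.2 k) hj]
  obtain ⟨k₂, hk₂, hset⟩ := eventually_const_of_antitone
    (fun k => ∑ j, setupSteps ((c k).proc j)) k₁ (fun k hk => by
      rcases hdec k hk with h1 | h1
      · exact h1.le
      · exact h1.1.le)
  replace hset : ∀ k ≥ k₂, setupSteps ((c k).proc (sched k)) = 0 ∧
      (c (k + 1)).tail = (c k).tail := by
    intro k hk
    rcases hdec k (by omega) with h1 | h1
    · exact absurd (hset k hk) h1.ne
    · exact h1.2
  have htail : ∀ k ≥ k₂, (c k).tail = (c k₂).tail := by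
    intro k hk
    induction k, hk using Nat.le_induction with
    | base => rfl
    | succ k hk ih => rw [(hset k hk).2, ih]
  have hdeq : ∀ k ≥ k₂, ∑ j, deqSteps n (c k₂).tail ((c (k + 1)).proc j) <
      ∑ j, deqSteps n (c k₂).tail ((c k).proc j) := by
    intro k hk
    have := Run.deqSteps_lt h (hlog k (by omega)) (hset k hk).1
    rw [htail k hk] at this
    exact Step.sum_proc_lt (h.2 k) _ this
  obtain ⟨k₃, hk₃, hc⟩ := eventually_const_of_antitone
    (fun k => ∑ j, deqSteps n (c k₂).tail ((c k).proc j)) k₂ (fun k hk => (hdeq k hk).le)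
  exact absurd (hc k₃ le_rfl) (hdeq k₃ hk₃).ne

theorem Step.pend_of_some {n : ℕ} {c c' : Config n} {i j : Fin n} (h : Step c i c')
    {a : QueueOp × ℕ} (hp : c'.pend j = some a) :
    c.pend j = some a ∨ (j = i ∧ c.pend i = none ∧ a.2 = c.time ∧ c'.log = c.log ∧
      ∀ r, c'.proc i ≠ PS.done r) := by
  by_cases hj : j = i
  · subst hj
    cases h <;> simp_all <;> simp [← hp]
  · rw [Step.pend_ne h hj] at hp
    exact Or.inl hp

theorem Step.done_of_pend {n : ℕ} {c c' : Config n} {i j : Fin n} (h : Step c i c')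
    {a : QueueOp × ℕ} {r : QueueRes} (hr : c.proc j = PS.done r) (hp : c'.pend j = some a) :
    c'.proc j = PS.done r := by
  by_cases hj : j = i
  · subst hj
    cases h <;> simp_all
  · rw [Step.proc_ne h hj, hr]

theorem Step.log_cases {n : ℕ} {c c' : Config n} {i : Fin n} (h : Step c i c') :
    (c'.log = c.log ∧ ∀ j a, c.pend j = some a → c'.pend j = some a) ∨
    ∃ res op t₀, c.proc i = PS.done res ∧ c.pend i = some (op, t₀) ∧ c'.pend i = none ∧
      c'.log = c.log ++ [⟨i, op, res, t₀, c.time⟩] := by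
  by_cases hd : ∃ res, c.proc i = PS.done res
  · right
    obtain ⟨res, hd⟩ := hd
    cases h <;> simp_all
  · left
    refine ⟨by cases h <;> simp_all, fun j a ha => ?_⟩
    by_cases hj : j = i
    · subst hj
      cases h <;> simp_all
    · rw [Step.pend_ne h hj, ha]

theorem Run.pend_past {n : ℕ} {c : ℕ → Config n} {sched : ℕ → Fin n} (h : Run c sched) {k : ℕ}
    {i : Fin n} {op : QueueOp} {t₀ : ℕ} (hp : (c k).pend i = some (op, t₀)) :
    t₀ < k ∧ sched t₀ = i ∧ ∀ j, t₀ < j → j ≤ k → (c j).pend i = some (op, t₀) := by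
  induction k with
  | zero => rw [h.1] at hp; simp [initConfig] at hp
  | succ k ih =>
    rcases Step.pend_of_some (h.2 k) hp with h1 | ⟨rfl, h1, h2, _⟩
    · obtain ⟨h3, h4, h5⟩ := ih h1
      refine ⟨by omega, h4, fun j hj hjk => ?_⟩
      rcases Nat.le_succ_iff.1 hjk with h6 | rfl
      · exact h5 j hj h6
      · exact hp
    · rw [Run.time_eq h] at h2
      dsimp only at h2
      subst h2
      refine ⟨by omega, rfl, fun j hj hjk => ?_⟩
      obtain rfl : j = t₀ + 1 := by omega
      exact hp

/-- Step `w` of the execution determines the result `res` of the operation `op` invoked at time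
`t₀`. -/
structure Decides {n : ℕ} (c : ℕ → Config n) (sched : ℕ → Fin n) (op : QueueOp) (t₀ : ℕ)
    (res : QueueRes) (w : ℕ) : Prop where
  pend : (c w).pend (sched w) = some (op, t₀)
  not_done : ∀ r, (c w).proc (sched w) ≠ PS.done r
  done : (c (w + 1)).proc (sched w) = PS.done res

theorem Step.pend_of_done {n : ℕ} {c c' : Config n} {i : Fin n} (h : Step c i c')
    {a : QueueOp × ℕ} {r : QueueRes} (hd : c'.proc i = PS.done r) (hp : c.pend i = some a) :
    c'.pend i = some a := by
  cases h <;> simp_all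

theorem Decides.persist {n : ℕ} {c : ℕ → Config n} {sched : ℕ → Fin n} {op : QueueOp}
    {t₀ : ℕ} {res : QueueRes} {w : ℕ} (hd : Decides c sched op t₀ res w) (h : Run c sched)
    {j : ℕ} (hj : w < j) (hp : (c j).pend (sched w) = some (op, t₀)) :
    (c j).proc (sched w) = PS.done res := by
  have h0 := (Run.pend_past h hd.pend).1
  have h2 := (Run.pend_past h hp).2.2
  induction j, hj using Nat.le_induction with
  | base => exact hd.done
  | succ j hj ih =>
    refine Step.done_of_pend (h.2 j) (ih (h2 j (by omega) (by omega)) ?_) hp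
    exact fun a ha hb => h2 a ha (by omega)

theorem Decides.unique {n : ℕ} {c : ℕ → Config n} {sched : ℕ → Fin n} {op op' : QueueOp}
    {t₀ : ℕ} {res res' : QueueRes} {w w' : ℕ} (hd : Decides c sched op t₀ res w)
    (hd' : Decides c sched op' t₀ res' w') (h : Run c sched) :
    w = w' ∧ op = op' ∧ res = res' := by
  have key : ∀ {op op' : QueueOp} {res res' : QueueRes} {w w' : ℕ},
      Decides c sched op t₀ res w → Decides c sched op' t₀ res' w' → ¬ w < w' := by
    intro op op' res res' w w' hd hd' hlt
    have h1 := Run.pend_past h hd.pend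
    have h2 := Run.pend_past h hd'.pend
    have hs : sched w = sched w' := h1.2.1.symm.trans h2.2.1
    have h3 := h2.2.2 w h1.1 hlt.le
    rw [← hs, hd.pend] at h3
    obtain rfl : op = op' := by simpa using h3
    refine hd'.not_done res ?_
    rw [← hs]
    exact hd.persist h hlt (hs ▸ hd'.pend)
  obtain rfl : w = w' := le_antisymm (not_lt.1 (key hd' hd)) (not_lt.1 (key hd hd'))
  have h1 := hd.pend.symm.trans hd'.pend
  have h2 := hd.done.symm.trans hd'.done
  simp_all

theorem Run.exists_decides {n : ℕ} {c : ℕ → Config n} {sched : ℕ → Fin n} (h : Run c sched)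
    {k : ℕ} {i : Fin n} {op : QueueOp} {t₀ : ℕ} {res : QueueRes}
    (hp : (c k).pend i = some (op, t₀)) (hd : (c k).proc i = PS.done res) :
    ∃ w < k, Decides c sched op t₀ res w ∧ sched w = i := by
  induction k with
  | zero => rw [h.1] at hp; simp [initConfig] at hp
  | succ k ih =>
    rcases Step.pend_of_some (h.2 k) hp with h1 | ⟨rfl, _, _, _, h1⟩
    · by_cases hdone : ∃ r, (c k).proc i = PS.done r
      · obtain ⟨r, hr⟩ := hdone
        have := Step.done_of_pend (h.2 k) hr hp
        rw [hd] at this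
        cases this
        obtain ⟨w, hw, h2⟩ := ih h1 hr
        exact ⟨w, by omega, h2⟩
      · have hi : i = sched k := by
          by_contra hi
          exact hdone ⟨res, (Step.proc_ne (h.2 k) hi).symm.trans hd⟩
        subst hi
        exact ⟨k, by omega, ⟨h1, fun r hr => hdone ⟨r, hr⟩, hd⟩, rfl⟩
    · exact absurd hd (h1 _)

theorem Run.log_decides {n : ℕ} {c : ℕ → Config n} {sched : ℕ → Fin n} (h : Run c sched)
    {k : ℕ} {e : LogEntry n} (he : e ∈ (c k).log) :
    e.retT < k ∧ ∃ w < e.retT, Decides c sched e.op e.invT e.res w := by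
  induction k with
  | zero => rw [h.1] at he; simp [initConfig] at he
  | succ k ih =>
    rcases Step.log_cases (h.2 k) with ⟨h1, _⟩ | ⟨res, op, t₀, h1, h2, _, h3⟩
    · rw [h1] at he
      have := ih he
      exact ⟨by omega, this.2⟩
    · rw [h3, List.mem_append, List.mem_singleton] at he
      rcases he with he | rfl
      · have := ih he
        exact ⟨by omega, this.2⟩
      · dsimp only
        rw [Run.time_eq h]
        obtain ⟨w, hw, hd, _⟩ := Run.exists_decides h h2 h1
        exact ⟨by omega, w, hw, hd⟩

theorem Decides.pend_or_log {n : ℕ} {c : ℕ → Config n} {sched : ℕ → Fin n} {op : QueueOp}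
    {t₀ : ℕ} {res : QueueRes} {w N : ℕ} (hd : Decides c sched op t₀ res w) (h : Run c sched)
    (hw : w < N) : (c N).pend (sched w) = some (op, t₀) ∨
      ∃ e ∈ (c N).log, e.op = op ∧ e.invT = t₀ ∧ e.res = res := by
  induction N, hw using Nat.le_induction with
  | base => exact Or.inl (Step.pend_of_done (h.2 w) hd.done hd.pend)
  | succ k hk ih =>
    rcases Step.log_cases (h.2 k) with ⟨h1, h2⟩ | ⟨res', op', t', h1, h2, _, h3⟩
    · rw [h1]
      exact ih.imp (h2 _ _) id
    · rcases ih with ih | ⟨e, he, h4⟩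
      · by_cases hs : sched w = sched k
        · right
          rw [h3]
          refine ⟨_, List.mem_append_right _ (List.mem_singleton_self _), ?_⟩
          have h5 := hd.persist h hk ih
          rw [hs] at ih h5
          rw [h2] at ih
          rw [h1] at h5
          simp_all
        · left
          rw [Step.pend_ne (h.2 k) hs, ih]
      · right
        rw [h3]
        exact ⟨e, List.mem_append_left _ he, h4⟩

theorem Run.log_nodup {n : ℕ} {c : ℕ → Config n} {sched : ℕ → Fin n} (h : Run c sched) (k : ℕ) :
    ((c k).log.map LogEntry.invT).Nodup ∧ ∀ e ∈ (c k).log, e.invT < k ∧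
      ∀ i op t, (c k).pend i = some (op, t) → e.invT ≠ t := by
  induction k with
  | zero => rw [h.1]; simp [initConfig]
  | succ k ih =>
    rcases Step.log_cases (h.2 k) with ⟨h1, _⟩ | ⟨res, op, t₀, h1, h2, h2', h3⟩
    · rw [h1]
      refine ⟨ih.1, fun e he => ⟨by have := (ih.2 e he).1; omega, fun i op t hp => ?_⟩⟩
      rcases Step.pend_of_some (h.2 k) hp with h4 | ⟨_, _, h4, _⟩
      · exact (ih.2 e he).2 i op t h4
      · have := (ih.2 e he).1
        rw [Run.time_eq h] at h4
        dsimp only at h4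
        omega
    · have hpast := Run.pend_past h h2
      rw [h3]
      constructor
      · rw [List.map_append, List.nodup_append]
        refine ⟨ih.1, by simp, ?_⟩
        intro a ha b hb
        obtain ⟨e, he, rfl⟩ := List.mem_map.1 ha
        simp only [List.map_cons, List.map_nil, List.mem_singleton] at hb
        subst hb
        exact (ih.2 e he).2 _ _ _ h2
      · intro e he
        rw [List.mem_append, List.mem_singleton] at he
        have hlt : e.invT < k := by
          rcases he with he | rfl
          · exact (ih.2 e he).1
          · exact hpast.1
        refine ⟨by omega, fun i op' t hp => ?_⟩
        have hi : i ≠ sched k := by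
          rintro rfl
          rw [h2'] at hp
          cases hp
        rw [Step.pend_ne (h.2 k) hi] at hp
        rcases he with he | rfl
        · exact (ih.2 e he).2 _ _ _ hp
        · rintro rfl
          exact hi ((Run.pend_past h hp).2.1.symm.trans hpast.2.1)

theorem historyAt_of_out {n : ℕ} {cfg : Config n} {a : Fin (historyAt cfg).m} {r : QueueRes}
    (hr : (historyAt cfg).out a = some r) : ∃ e ∈ cfg.log, (historyAt cfg).op a = e.op ∧
      (historyAt cfg).inv a = e.invT ∧ (historyAt cfg).ret a = some e.retT ∧ r = e.res := by
  by_cases ha : (a : ℕ) < cfg.log.length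
  · refine ⟨cfg.log.get ⟨a, ha⟩, List.get_mem _ _, ?_⟩
    simp only [historyAt, dif_pos ha, Option.some.injEq] at hr ⊢
    exact ⟨trivial, trivial, trivial, hr.symm⟩
  · simp [historyAt, dif_neg ha] at hr

theorem historyAt_of_ret {n : ℕ} {cfg : Config n} {a : Fin (historyAt cfg).m} {t : ℕ}
    (ht : (historyAt cfg).ret a = some t) : ∃ e ∈ cfg.log, (historyAt cfg).op a = e.op ∧
      (historyAt cfg).inv a = e.invT ∧ t = e.retT := by
  by_cases ha : (a : ℕ) < cfg.log.length
  · refine ⟨cfg.log.get ⟨a, ha⟩, List.get_mem _ _, ?_⟩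
    simp only [historyAt, dif_pos ha, Option.some.injEq] at ht ⊢
    exact ⟨trivial, trivial, ht.symm⟩
  · simp [historyAt, dif_neg ha] at ht

theorem exists_historyAt_of_log {n : ℕ} {cfg : Config n} {e : LogEntry n} (he : e ∈ cfg.log) :
    ∃ a, (historyAt cfg).op a = e.op ∧ (historyAt cfg).inv a = e.invT := by
  obtain ⟨⟨a, ha⟩, rfl⟩ := List.mem_iff_get.1 he
  refine ⟨⟨a, Nat.lt_add_right _ ha⟩, ?_⟩
  simp only [historyAt, dif_pos ha]
  exact ⟨trivial, trivial⟩

theorem exists_historyAt_of_pend {n : ℕ} {cfg : Config n} {i : Fin n} {op : QueueOp} {t : ℕ}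
    (hp : cfg.pend i = some (op, t)) :
    ∃ a, (historyAt cfg).op a = op ∧ (historyAt cfg).inv a = t := by
  have hm : (op, t) ∈ pendingList cfg := List.mem_filterMap.2 ⟨i, List.mem_finRange i, hp⟩
  obtain ⟨⟨a, ha⟩, hget⟩ := List.mem_iff_get.1 hm
  refine ⟨⟨cfg.log.length + a, Nat.add_lt_add_left ha _⟩, ?_⟩
  have hn : ¬ cfg.log.length + a < cfg.log.length := by omega
  simp only [historyAt, dif_neg hn, Nat.add_sub_cancel_left, List.getD_eq_getElem _ _ ha]
  rw [List.get_eq_getElem] at hget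
  simp [hget]

theorem Run.historyAt_inj {n : ℕ} {c : ℕ → Config n} {sched : ℕ → Fin n} (h : Run c sched)
    {N : ℕ} {a b : Fin (historyAt (c N)).m}
    (hab : (historyAt (c N)).inv a = (historyAt (c N)).inv b) : a = b := by
  set L := (c N).log.map LogEntry.invT ++ (pendingList (c N)).map Prod.snd with hL
  have hlen : L.length = (historyAt (c N)).m := by simp [L, historyAt]
  have hget : ∀ a : Fin (historyAt (c N)).m,
      (historyAt (c N)).inv a = L[(a : ℕ)]'(by rw [hlen]; exact a.2) := by
    intro a
    have ha2 : (a : ℕ) < (c N).log.length + (pendingList (c N)).length := a.2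
    simp only [hL, List.getElem_append, List.length_map, historyAt]
    split_ifs with ha
    · simp
    · rw [List.getD_eq_getElem _ _ (by omega)]
      simp
  have hnd : L.Nodup := by
    have hlog := Run.log_nodup h N
    rw [hL, List.nodup_append]
    refine ⟨hlog.1, ?_, ?_⟩
    · rw [pendingList, List.map_filterMap]
      refine List.Nodup.filterMap ?_ (List.nodup_finRange n)
      intro i j t hi hj
      simp only [Option.mem_def, Option.map_eq_some_iff, Prod.exists] at hi hj
      obtain ⟨op, _, hi, rfl⟩ := hi
      obtain ⟨op', _, hj, rfl⟩ := hj
      exact (Run.pend_past h hi).2.1.symm.trans (Run.pend_past h hj).2.1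
    · intro t ht t' ht'
      obtain ⟨e, he, rfl⟩ := List.mem_map.1 ht
      obtain ⟨⟨op, t''⟩, hp, rfl⟩ := List.mem_map.1 ht'
      obtain ⟨i, _, hi⟩ := List.mem_filterMap.1 hp
      exact (hlog.2 e he).2 i op t'' hi
  rw [hget, hget, hnd.getElem_inj_iff] at hab
  exact Fin.ext hab

theorem Decides.exists_historyAt {n : ℕ} {c : ℕ → Config n} {sched : ℕ → Fin n} {op : QueueOp}
    {t₀ : ℕ} {res : QueueRes} {w N : ℕ} (hd : Decides c sched op t₀ res w) (h : Run c sched)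
    (hw : w < N) : ∃ a, (historyAt (c N)).op a = op ∧ (historyAt (c N)).inv a = t₀ := by
  rcases hd.pend_or_log h hw with h1 | ⟨e, he, rfl, rfl, rfl⟩
  · exact exists_historyAt_of_pend h1
  · exact exists_historyAt_of_log he

/-- Step `w` is the write of the enqueue of `x` invoked at time `t₀` into the entry `p`. -/
structure Enqueues {n : ℕ} (c : ℕ → Config n) (sched : ℕ → Fin n) (x t₀ w : ℕ) (p : ℕ × ℕ) :
    Prop where
  decides : Decides c sched (QueueOp.enq x) t₀ QueueRes.ok w
  bot : (c w).items p.1 p.2 = Cell.bot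
  val : (c (w + 1)).items p.1 p.2 = Cell.val x
  tail : ∃ u, t₀ < u ∧ u < w ∧ (c u).tail = p.1

/-- Step `w` is the write of the dequeue invoked at time `t₀` that takes `x` from the entry `p`. -/
structure Dequeues {n : ℕ} (c : ℕ → Config n) (sched : ℕ → Fin n) (x t₀ w : ℕ) (p : ℕ × ℕ) :
    Prop where
  decides : Decides c sched QueueOp.deq t₀ (QueueRes.val x) w
  proc : ∃ tk' tk tl, (c w).proc (sched w) = PS.deqWrite tk' tk tl p.1 p.2 (Cell.val x)
  read : ∃ k₀, t₀ < k₀ ∧ k₀ < w ∧ (c k₀).items p.1 p.2 = Cell.val x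
  mark : (c (w + 1)).items p.1 p.2 = Cell.mark

/-- Step `w` makes the dequeue invoked at time `t₀` return `ε`, and no item was present in
configuration `τ`. -/
structure FindsEmpty {n : ℕ} (c : ℕ → Config n) (sched : ℕ → Fin n) (t₀ w τ : ℕ) : Prop where
  decides : Decides c sched QueueOp.deq t₀ QueueRes.empty w
  lt : t₀ < τ
  lt_step : τ < w
  noItem : NoItem (c τ)

theorem Run.enqueues_of_enq3 {n : ℕ} {c : ℕ → Config n} {sched : ℕ → Fin n} (h : Run c sched)
    {x r w : ℕ} (hp : (c w).proc (sched w) = PS.enq3 x r)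
    (hd : (c (w + 1)).proc (sched w) = PS.done QueueRes.ok)
    (hv : (c (w + 1)).items r (sched w + 1) = Cell.val x) :
    ∃ t₀, Enqueues c sched x t₀ w (r, sched w + 1) := by
  have hl := Run.localInv h w (sched w)
  have hm := (Run.memInv h w).enq3 _ _ _ hp
  simp only [LocalInv, hp] at hl
  obtain ⟨t₀, u, h1, h2, h3, h4⟩ := hl
  exact ⟨t₀, ⟨h1, by simp [hp], hd⟩, hm.2.2 r le_rfl, hv, u, h2, h3, h4⟩

theorem Run.dequeues_of_deqWrite {n : ℕ} {c : ℕ → Config n} {sched : ℕ → Fin n}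
    (h : Run c sched) {tk' tk tl r s x w : ℕ}
    (hp : (c w).proc (sched w) = PS.deqWrite tk' tk tl r s (Cell.val x))
    (hd : (c (w + 1)).proc (sched w) = PS.done (QueueRes.val x))
    (hv : (c (w + 1)).items r s = Cell.mark) :
    ∃ t₀, Dequeues c sched x t₀ w (r, s) := by
  have hl := Run.localInv h w (sched w)
  simp only [LocalInv, hp] at hl
  obtain ⟨t₀, τ, k₀, h1, h2, h3, h4, h5, h6⟩ := hl
  exact ⟨t₀, ⟨h1, by simp [hp], hd⟩, ⟨tk', tk, tl, hp⟩, ⟨k₀, by omega, h4, h5⟩, hv⟩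

theorem Step.done_cases {n : ℕ} {c c' : Config n} {i : Fin n} (h : Step c i c')
    {res : QueueRes} (hd : c'.proc i = PS.done res) (hn : ∀ r, c.proc i ≠ PS.done r) :
    (res = QueueRes.ok ∧ ∃ x r, c.proc i = PS.enq3 x r ∧ c'.items r (i + 1) = Cell.val x) ∨
    (∃ x tk' tk tl r s, res = QueueRes.val x ∧
      c.proc i = PS.deqWrite tk' tk tl r s (Cell.val x) ∧ c'.items r s = Cell.mark) ∨
    (res = QueueRes.empty ∧ ∃ tk, c.proc i = PS.deqCheck tk tk) := by
  cases h <;> simp_all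

theorem Decides.cases {n : ℕ} {c : ℕ → Config n} {sched : ℕ → Fin n} {op : QueueOp}
    {t₀ : ℕ} {res : QueueRes} {w : ℕ} (hd : Decides c sched op t₀ res w) (h : Run c sched) :
    (∃ x p, op = QueueOp.enq x ∧ res = QueueRes.ok ∧ Enqueues c sched x t₀ w p) ∨
    (∃ x p, op = QueueOp.deq ∧ res = QueueRes.val x ∧ Dequeues c sched x t₀ w p) ∨
    (op = QueueOp.deq ∧ res = QueueRes.empty ∧ ∃ τ, FindsEmpty c sched t₀ w τ) := by
  have hp := hd.pend
  rcases Step.done_cases (h.2 w) hd.done hd.not_done with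
    ⟨rfl, x, r, h1, h2⟩ | ⟨x, tk', tk, tl, r, s, rfl, h1, h2⟩ | ⟨rfl, tk, h1⟩
  · obtain ⟨t₀', h3⟩ := Run.enqueues_of_enq3 h h1 hd.done h2
    have := h3.decides.pend.symm.trans hp
    simp only [Option.some.injEq, Prod.mk.injEq] at this
    obtain ⟨rfl, rfl⟩ := this
    exact Or.inl ⟨x, _, rfl, rfl, h3⟩
  · obtain ⟨t₀', h3⟩ := Run.dequeues_of_deqWrite h h1 hd.done h2
    have := h3.decides.pend.symm.trans hp
    simp only [Option.some.injEq, Prod.mk.injEq] at this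
    obtain ⟨rfl, rfl⟩ := this
    exact Or.inr (Or.inl ⟨x, _, rfl, rfl, h3⟩)
  · have hl := Run.localInv h w (sched w)
    simp only [LocalInv, h1] at hl
    obtain ⟨t₀', τ, h2, h3, h4, _, _, h5⟩ := hl
    have := h2.symm.trans hp
    simp only [Option.some.injEq, Prod.mk.injEq] at this
    obtain ⟨rfl, rfl⟩ := this
    exact Or.inr (Or.inr ⟨rfl, rfl, τ, hd, h3, h4, h5 trivial⟩)

theorem Step.items_changed_unique {n : ℕ} {c c' : Config n} {i : Fin n} (h : Step c i c')
    (hc : MemInv c) {p q : ℕ × ℕ} (hp : c'.items p.1 p.2 ≠ c.items p.1 p.2)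
    (hq : c'.items q.1 q.2 ≠ c.items q.1 q.2) : p = q := by
  rcases Step.items h hc p.1 p.2 with h1 | ⟨_, x, h1, h2, _⟩ | ⟨y, _, _, _, _, _, _, h1, _⟩
  · exact absurd h1 hp
  · rcases Step.items h hc q.1 q.2 with h3 | ⟨_, x', h3, h4, _⟩ | ⟨y', _, _, _, _, _, _, h3, _⟩
    · exact absurd h3 hq
    · rw [h1] at h3
      simp only [PS.enq3.injEq] at h3
      exact Prod.ext h3.2 (h2.trans h4.symm)
    · rw [h1] at h3
      cases h3
  · rcases Step.items h hc q.1 q.2 with h3 | ⟨_, x', h3, h4, _⟩ | ⟨y', _, _, _, _, _, _, h3, _⟩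
    · exact absurd h3 hq
    · rw [h1] at h3
      cases h3
    · rw [h1] at h3
      simp only [PS.deqWrite.injEq] at h3
      exact Prod.ext h3.2.2.2.1 h3.2.2.2.2.1

/-- The index of the first configuration in which the entry `p` of `Items` is not ⊥. -/
noncomputable def writeTime {n : ℕ} (c : ℕ → Config n) (p : ℕ × ℕ) : ℕ :=
  sInf {k | (c k).items p.1 p.2 ≠ Cell.bot}

/-- The index of the first configuration up to `N` in which the entry `p` of `Items` is ⊤, and
`N + 1` if there is none. -/
noncomputable def markTime {n : ℕ} (c : ℕ → Config n) (N : ℕ) (p : ℕ × ℕ) : ℕ :=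
  sInf {k | N < k ∨ (c k).items p.1 p.2 = Cell.mark}

theorem Later.ne_bot {n : ℕ} {c c' : Config n} (h : Later c c') {r s : ℕ}
    (hb : c.items r s ≠ Cell.bot) : c'.items r s ≠ Cell.bot :=
  fun hb' => hb (h.bot hb')

theorem Run.writeTime_le_iff {n : ℕ} {c : ℕ → Config n} {sched : ℕ → Fin n} (h : Run c sched)
    {N k : ℕ} {p : ℕ × ℕ} (hw : (c N).items p.1 p.2 ≠ Cell.bot) :
    writeTime c p ≤ k ↔ (c k).items p.1 p.2 ≠ Cell.bot := by
  have hmem : writeTime c p ∈ {k | (c k).items p.1 p.2 ≠ Cell.bot} := Nat.sInf_mem ⟨N, hw⟩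
  exact ⟨fun hk => (Run.later h hk).ne_bot hmem, fun hk => Nat.sInf_le hk⟩

theorem markTime_le {n : ℕ} (c : ℕ → Config n) (N : ℕ) (p : ℕ × ℕ) : markTime c N p ≤ N + 1 :=
  Nat.sInf_le (Or.inl (Nat.lt_succ_self N))

theorem Run.markTime_le_iff {n : ℕ} {c : ℕ → Config n} {sched : ℕ → Fin n} (h : Run c sched)
    {N k : ℕ} {p : ℕ × ℕ} (hk : k ≤ N) :
    markTime c N p ≤ k ↔ (c k).items p.1 p.2 = Cell.mark := by
  have hmem : markTime c N p ∈ {k | N < k ∨ (c k).items p.1 p.2 = Cell.mark} :=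
    Nat.sInf_mem ⟨N + 1, Or.inl (Nat.lt_succ_self N)⟩
  refine ⟨fun hm => ?_, fun hm => Nat.sInf_le (Or.inr hm)⟩
  rcases hmem with h1 | h1
  · omega
  · exact (Run.later h hm).mark _ _ h1

theorem Run.writeTime_lt_markTime {n : ℕ} {c : ℕ → Config n} {sched : ℕ → Fin n}
    (h : Run c sched) {N : ℕ} {p : ℕ × ℕ} (hw : (c N).items p.1 p.2 ≠ Cell.bot) :
    ∃ w < N, writeTime c p = w + 1 ∧ w + 1 < markTime c N p ∧
      ∃ x t₀, Enqueues c sched x t₀ w p := by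
  have hle := (Run.writeTime_le_iff h hw).2 hw
  have hiff := fun k => Run.writeTime_le_iff (k := k) h hw
  have hpos : writeTime c p ≠ 0 := by
    intro h0
    have := (hiff 0).1 h0.le
    rw [h.1] at this
    exact this rfl
  obtain ⟨w, hwt⟩ := Nat.exists_eq_succ_of_ne_zero hpos
  rw [Nat.succ_eq_add_one] at hwt
  have h1 : (c (w + 1)).items p.1 p.2 ≠ Cell.bot := (hiff _).1 hwt.le
  have h2 : (c w).items p.1 p.2 = Cell.bot := by
    by_contra hb
    have := (hiff w).2 hb
    omega
  refine ⟨w, by omega, hwt, ?_⟩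
  rcases Step.items (h.2 w) (Run.memInv h w) p.1 p.2 with h3 | ⟨_, x, h3, h4, h5, h6⟩ | ⟨y, h3, _⟩
  · rw [h3] at h1
    exact absurd h2 h1
  · obtain ⟨t₀, he⟩ := Run.enqueues_of_enq3 h h3 h6 (h4 ▸ h5)
    have hp : (p.1, (sched w : ℕ) + 1) = p := Prod.ext rfl h4.symm
    rw [hp] at he
    refine ⟨?_, x, t₀, he⟩
    by_contra hm
    have := (Run.markTime_le_iff h (p := p) (k := w + 1) (N := N) (by omega)).1 (by omega)
    rw [h5] at this
    cases this
  · rw [h2] at h3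
    cases h3

theorem Enqueues.writeTime_eq {n : ℕ} {c : ℕ → Config n} {sched : ℕ → Fin n} {x t₀ w : ℕ}
    {p : ℕ × ℕ} (he : Enqueues c sched x t₀ w p) (h : Run c sched) : writeTime c p = w + 1 := by
  have h1 : (c (w + 1)).items p.1 p.2 ≠ Cell.bot := by simp [he.val]
  refine le_antisymm ((Run.writeTime_le_iff h h1).2 h1) ?_
  by_contra hlt
  exact (Run.writeTime_le_iff (k := w) h h1).1 (by omega) he.bot

theorem Run.writeTime_inj {n : ℕ} {c : ℕ → Config n} {sched : ℕ → Fin n} (h : Run c sched)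
    {N : ℕ} {p q : ℕ × ℕ} (hp : (c N).items p.1 p.2 ≠ Cell.bot)
    (hq : (c N).items q.1 q.2 ≠ Cell.bot) (hpq : writeTime c p = writeTime c q) : p = q := by
  obtain ⟨w, _, h1, _, x, t₀, h2⟩ := Run.writeTime_lt_markTime h hp
  obtain ⟨w', _, h1', _, x', t₀', h2'⟩ := Run.writeTime_lt_markTime h hq
  obtain rfl : w = w' := by omega
  apply Step.items_changed_unique (h.2 w) (Run.memInv h w)
  · simp [h2.bot, h2.val]
  · simp [h2'.bot, h2'.val]

theorem Run.exists_dequeues {n : ℕ} {c : ℕ → Config n} {sched : ℕ → Fin n}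
    (h : Run c sched) {N : ℕ} {p : ℕ × ℕ} (hm : markTime c N p ≤ N) :
    ∃ w < N, markTime c N p = w + 1 ∧ (c w).items p.1 p.2 ≠ Cell.mark ∧
      (c (w + 1)).items p.1 p.2 = Cell.mark ∧ ∃ x t₀, Dequeues c sched x t₀ w p := by
  have hpos : markTime c N p ≠ 0 := by
    intro h0
    have := (Run.markTime_le_iff h (Nat.zero_le N)).1 h0.le
    rw [h.1] at this
    cases this
  obtain ⟨w, hw⟩ := Nat.exists_eq_succ_of_ne_zero hpos
  rw [Nat.succ_eq_add_one] at hw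
  have h1 := (Run.markTime_le_iff h (p := p) (k := w + 1) (N := N) (by omega)).1 hw.le
  have h2 : (c w).items p.1 p.2 ≠ Cell.mark := by
    intro hb
    have := (Run.markTime_le_iff h (p := p) (k := w) (N := N) (by omega)).2 hb
    omega
  refine ⟨w, by omega, hw, h2, h1, ?_⟩
  rcases Step.items (h.2 w) (Run.memInv h w) p.1 p.2 with
    h3 | ⟨_, x, h3, h4, h5, h6⟩ | ⟨y, _, _, tk', tk, tl, x, h3, h4⟩
  · rw [h3] at h1
    exact absurd h1 h2
  · rw [h5] at h1
    cases h1
  · obtain ⟨t₀, hd⟩ := Run.dequeues_of_deqWrite h h3 h4 h1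
    exact ⟨x, t₀, hd⟩

theorem Run.markTime_inj {n : ℕ} {c : ℕ → Config n} {sched : ℕ → Fin n} (h : Run c sched)
    {N : ℕ} {p q : ℕ × ℕ} (hp : markTime c N p ≤ N)
    (hpq : markTime c N p = markTime c N q) : p = q := by
  obtain ⟨w, _, h1, h2, h3, _⟩ := Run.exists_dequeues h hp
  obtain ⟨w', _, h1', h2', h3', _⟩ := Run.exists_dequeues h (hpq ▸ hp)
  obtain rfl : w = w' := by omega
  apply Step.items_changed_unique (h.2 w) (Run.memInv h w)
  · rw [h3]
    exact h2.symm
  · rw [h3']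
    exact h2'.symm

/-- An entry already written when the enqueue into `p` is invoked is taken no later than `p`. -/
theorem Enqueues.markTime_le {n : ℕ} {c : ℕ → Config n} {sched : ℕ → Fin n} {x t₀ w N : ℕ}
    {p q : ℕ × ℕ} (he : Enqueues c sched x t₀ w p) (h : Run c sched)
    (hq : (c t₀).items q.1 q.2 ≠ Cell.bot) (hm : markTime c N p ≤ N) :
    markTime c N q ≤ markTime c N p := by
  obtain ⟨v, hv, h1, h2, h3, y, t₁, hd⟩ := Run.exists_dequeues h hm
  obtain ⟨tk', tk, tl, hproc⟩ := hd.proc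
  have hl := Run.localInv h v (sched v)
  simp only [LocalInv, hproc] at hl
  obtain ⟨t₁, τ, k₀, _, h4, h5, h6, _, h7⟩ := hl
  obtain ⟨u, h8, h9, h10⟩ := he.tail
  have hrange := (Run.memInv h t₀).range _ _ hq
  have htl := (Run.later h h8.le).tail
  have hrow := h7.row_le
  have htail := h7.tail
  have hut : u < τ := by
    by_contra hlt
    have := (Run.later h (not_lt.1 hlt)).tail
    omega
  have hmark := h7.seen.marked q (mem_scanned.2 (by omega))
    ((Run.later h (by omega : t₀ ≤ τ)).ne_bot hq)
  have := (Run.markTime_le_iff h (by omega : v ≤ N)).2 hmark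
  omega

theorem Dequeues.facts {n : ℕ} {c : ℕ → Config n} {sched : ℕ → Fin n} {x t₀ w N : ℕ}
    {p : ℕ × ℕ} (hd : Dequeues c sched x t₀ w p) (h : Run c sched) (hw : w < N) :
    (c N).items p.1 p.2 ≠ Cell.bot ∧ t₀ + 1 < markTime c N p ∧ markTime c N p ≤ w + 1 ∧
      ∀ j, t₀ < j → j ≤ w → (c j).pend (sched w) = some (QueueOp.deq, t₀) := by
  have h1 := hd.mark
  refine ⟨?_, ?_, (Run.markTime_le_iff h (by omega)).2 h1,
    (Run.pend_past h hd.decides.pend).2.2⟩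
  · rw [(Run.later h (by omega : w + 1 ≤ N)).mark _ _ h1]
    simp
  · obtain ⟨k₀, h2, h3, h4⟩ := hd.read
    by_contra hle
    have := (Run.markTime_le_iff h (p := p) (k := k₀) (N := N) (by omega)).1 (by omega)
    rw [h4] at this
    cases this

theorem Dequeues.enqueues_val {n : ℕ} {c : ℕ → Config n} {sched : ℕ → Fin n}
    {x x' t₀ t₀' w w' : ℕ} {p : ℕ × ℕ} (hd : Dequeues c sched x t₀ w p)
    (he : Enqueues c sched x' t₀' w' p) (h : Run c sched) : x = x' := by
  obtain ⟨k₀, _, _, h1⟩ := hd.read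
  have h2 : (c k₀).items p.1 p.2 ≠ Cell.bot := by simp [h1]
  have h3 := (Run.writeTime_le_iff h h2).2 h2
  rw [he.writeTime_eq h] at h3
  rcases (Run.later h h3).val _ _ _ he.val with h4 | h4
  · rw [h1] at h4
    exact Cell.val.inj h4
  · rw [h1] at h4
    cases h4

/-- The configuration index at which the enqueue into the entry `p` is linearized. -/
noncomputable def enqTime {n : ℕ} (c : ℕ → Config n) (N : ℕ) (p : ℕ × ℕ) : ℕ :=
  sInf {k | ∃ q : ℕ × ℕ, k = writeTime c q ∧ (c N).items q.1 q.2 ≠ Cell.bot ∧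
    (q = p ∨ markTime c N p < markTime c N q)}

theorem enqTime_le_writeTime {n : ℕ} {c : ℕ → Config n} {N : ℕ} {p : ℕ × ℕ}
    (hp : (c N).items p.1 p.2 ≠ Cell.bot) : enqTime c N p ≤ writeTime c p :=
  Nat.sInf_le ⟨p, rfl, hp, Or.inl rfl⟩

theorem exists_enqTime {n : ℕ} {c : ℕ → Config n} {N : ℕ} {p : ℕ × ℕ}
    (hp : (c N).items p.1 p.2 ≠ Cell.bot) :
    ∃ q : ℕ × ℕ, enqTime c N p = writeTime c q ∧ (c N).items q.1 q.2 ≠ Cell.bot ∧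
      (q = p ∨ markTime c N p < markTime c N q) :=
  Nat.sInf_mem (s := {k | ∃ q : ℕ × ℕ, k = writeTime c q ∧ (c N).items q.1 q.2 ≠ Cell.bot ∧
    (q = p ∨ markTime c N p < markTime c N q)}) ⟨_, p, rfl, hp, Or.inl rfl⟩

theorem enqTime_mono {n : ℕ} {c : ℕ → Config n} {N : ℕ} {p q : ℕ × ℕ}
    (hq : (c N).items q.1 q.2 ≠ Cell.bot) (hpq : markTime c N p < markTime c N q) :
    enqTime c N p ≤ enqTime c N q := by
  obtain ⟨q', h1, h2, h3⟩ := exists_enqTime hq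
  rw [h1]
  refine Nat.sInf_le ⟨q', rfl, h2, Or.inr ?_⟩
  rcases h3 with rfl | h3
  · exact hpq
  · exact hpq.trans h3

theorem Enqueues.lt_enqTime {n : ℕ} {c : ℕ → Config n} {sched : ℕ → Fin n} {x t₀ w N : ℕ}
    {p : ℕ × ℕ} (he : Enqueues c sched x t₀ w p) (h : Run c sched)
    (hp : (c N).items p.1 p.2 ≠ Cell.bot) : t₀ < enqTime c N p := by
  obtain ⟨q, h1, h2, h3⟩ := exists_enqTime hp
  rw [h1]
  by_contra hle
  have hq := (Run.writeTime_le_iff h h2).1 (not_lt.1 hle)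
  rcases h3 with rfl | h3
  · have := he.writeTime_eq h
    have := (Run.pend_past h he.decides.pend).1
    omega
  · have := _root_.markTime_le c N q
    have := he.markTime_le h (N := N) hq (by omega)
    omega

theorem Run.enqTime_inj {n : ℕ} {c : ℕ → Config n} {sched : ℕ → Fin n} (h : Run c sched)
    {N : ℕ} {p q : ℕ × ℕ} (hp : (c N).items p.1 p.2 ≠ Cell.bot)
    (hq : (c N).items q.1 q.2 ≠ Cell.bot) (hm : markTime c N p = markTime c N q)
    (he : enqTime c N p = enqTime c N q) : p = q := by
  by_cases hle : markTime c N p ≤ N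
  · exact Run.markTime_inj h hle hm
  · obtain ⟨p', h1, h2, h3⟩ := exists_enqTime hp
    obtain ⟨q', h1', h2', h3'⟩ := exists_enqTime hq
    have h4 := markTime_le c N p'
    have h5 := markTime_le c N q'
    have h6 : p' = p := h3.resolve_right (by omega)
    have h7 : q' = q := h3'.resolve_right (by omega)
    subst h6 h7
    exact Run.writeTime_inj h h2 h2' (by omega)

theorem NoItem.markTime_le {n : ℕ} {c : ℕ → Config n} {sched : ℕ → Fin n} (h : Run c sched)
    {N τ : ℕ} (hn : NoItem (c τ)) (hτ : τ ≤ N) {p : ℕ × ℕ}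
    (hp : (c N).items p.1 p.2 ≠ Cell.bot) (hle : enqTime c N p ≤ τ) : markTime c N p ≤ τ := by
  obtain ⟨q, h1, h2, h3⟩ := exists_enqTime hp
  have h4 := (Run.writeTime_le_iff h h2).1 (h1 ▸ hle)
  have h5 : (c τ).items q.1 q.2 = Cell.mark := by
    cases h6 : (c τ).items q.1 q.2 with
    | bot => exact absurd h6 h4
    | mark => rfl
    | val x => exact absurd h6 (hn _ _ x)
  have h7 := (Run.markTime_le_iff h hτ).2 h5
  rcases h3 with rfl | h3 <;> omega

/-- Contents of the queue before class `k`, when the classes in `E` are the enqueues, class `j ∈ E`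
enqueues `v j`, and this item is dequeued by class `d j`. -/
noncomputable def queueContents (E : Set ℕ) (d v : ℕ → ℕ) (k : ℕ) : List ℕ :=
  open Classical in ((List.range k).filter (fun j => j ∈ E ∧ k ≤ d j)).map v

theorem queueContents_enq {E : Set ℕ} {d : ℕ → ℕ} (v : ℕ → ℕ) {k : ℕ} (hk : k ∈ E) (hd : k < d k)
    (hne : ∀ j ∈ E, j < k → d j ≠ k) :
    queueContents E d v (k + 1) = queueContents E d v k ++ [v k] := by
  classical
  unfold queueContents
  rw [List.range_succ, List.filter_append, List.map_append]
  congr 1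
  · congr 1
    apply List.filter_congr
    intro j hj
    have hj' := List.mem_range.1 hj
    simp only [decide_eq_decide]
    refine and_congr_right fun hE => ?_
    have := hne j hE hj'
    omega
  · simp [hk, hd]

theorem queueContents_empty {E : Set ℕ} {d : ℕ → ℕ} (v : ℕ → ℕ) {k : ℕ} (hk : k ∉ E)
    (hlt : ∀ j ∈ E, j < k → d j < k) :
    queueContents E d v k = [] ∧ queueContents E d v (k + 1) = [] := by
  classical
  unfold queueContents
  simp only [List.map_eq_nil_iff, List.filter_eq_nil_iff, List.mem_range, decide_eq_true_eq]
  refine ⟨fun j hj h => ?_, fun j hj h => ?_⟩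
  · have := hlt j h.1 hj
    omega
  · rcases Nat.lt_succ_iff_lt_or_eq.1 hj with h1 | rfl
    · have := hlt j h.1 h1
      omega
    · exact hk h.1

theorem queueContents_deq {E : Set ℕ} {d : ℕ → ℕ} (v : ℕ → ℕ) {k j₀ : ℕ} (hk : k ∉ E)
    (hj₀ : j₀ ∈ E) (hj₀k : j₀ < k) (hd : d j₀ = k) (hlt : ∀ j ∈ E, j < j₀ → d j < k)
    (hinj : ∀ j ∈ E, d j = k → j = j₀) :
    queueContents E d v k = v j₀ :: queueContents E d v (k + 1) := by
  classical
  obtain ⟨m, rfl⟩ := Nat.exists_eq_add_of_lt hj₀k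
  have hsplit : List.range (j₀ + m + 1) =
      List.range j₀ ++ j₀ :: (List.range m).map (fun a => j₀ + 1 + a) := by
    rw [show j₀ + m + 1 = (j₀ + 1) + m by omega, List.range_add, List.range_succ]
    simp
  have hnil : ∀ b, j₀ + m + 1 ≤ b →
      (List.range j₀).filter (fun j => j ∈ E ∧ b ≤ d j) = [] := by
    intro b hb
    simp only [List.filter_eq_nil_iff, List.mem_range, decide_eq_true_eq]
    intro j hj h
    have := hlt j h.1 hj
    omega
  unfold queueContents
  rw [List.range_succ (n := j₀ + m + 1), List.filter_append, hsplit, List.filter_append,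
    List.filter_append,
    hnil _ le_rfl, hnil _ (by omega), List.filter_cons_of_pos (by simp [hj₀, hd]),
    List.filter_cons_of_neg (by simp [hd]), List.filter_cons_of_neg (by simp [hk])]
  simp only [List.nil_append, List.map_cons, List.filter_nil, List.append_nil]
  congr 2
  apply List.filter_congr
  intro j hj
  simp only [decide_eq_decide]
  refine and_congr_right fun hE => ?_
  have h1 : d j ≠ j₀ + m + 1 := fun h => by
    have := hinj j hE h
    simp only [List.mem_map] at hj
    omega
  omega

/-- A linearization of a history described by a linearly ordered key for every linearized
operation (the classes are the sets of operations with the same key) and, for every dequeue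
returning an item, the enqueue of this item. -/
structure KeyedLinearization {α : Type*} [LinearOrder α] (n : ℕ)
    (h : ConcHistory QueueOp QueueRes) (lin : Fin h.m → Prop) (lout : Fin h.m → QueueRes)
    (key : Fin h.m → α) (src : Fin h.m → Fin h.m) : Prop where
  complete : ∀ i, (h.out i).isSome → lin i
  out_agree : ∀ i r, h.out i = some r → lout i = r
  kind : ∀ i, lin i → (∃ x, h.op i = QueueOp.enq x ∧ lout i = QueueRes.ok) ∨
    (h.op i = QueueOp.deq ∧ ∃ x, lout i = QueueRes.val x) ∨
    (h.op i = QueueOp.deq ∧ lout i = QueueRes.empty)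
  order : ∀ i j, h.precedes i j → lin i → lin j → key i < key j
  single : ∀ i j, lin i → lin j → key i = key j →
    i = j ∨ (∃ x, lout i = QueueRes.val x) ∧ ∃ x, lout j = QueueRes.val x
  src_spec : ∀ i x, lin i → lout i = QueueRes.val x →
    lin (src i) ∧ h.op (src i) = QueueOp.enq x ∧ key (src i) < key i
  src_key : ∀ i x j y, lin i → lout i = QueueRes.val x → lin j → lout j = QueueRes.val y →
    (src i = src j ↔ key i = key j)
  fifo : ∀ i x j y, lin i → lout i = QueueRes.val x → lin j → h.op j = QueueOp.enq y →
    key j < key (src i) → ∃ i', lin i' ∧ (∃ z, lout i' = QueueRes.val z) ∧ src i' = j ∧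
      key i' < key i
  empty : ∀ i j y, lin i → lout i = QueueRes.empty → lin j → h.op j = QueueOp.enq y →
    key j < key i → ∃ i', lin i' ∧ (∃ z, lout i' = QueueRes.val z) ∧ src i' = j ∧ key i' < key i
  card : ∀ i x, lin i → lout i = QueueRes.val x → ∀ C : Finset (Fin h.m),
    (∀ j ∈ C, lin j ∧ key j = key i) → C.card ≤ n

theorem KeyedLinearization.rekey {α β : Type*} [LinearOrder α] [LinearOrder β] {n : ℕ}
    {h : ConcHistory QueueOp QueueRes} {lin : Fin h.m → Prop} {lout : Fin h.m → QueueRes}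
    {key : Fin h.m → α} {src : Fin h.m → Fin h.m} (H : KeyedLinearization n h lin lout key src)
    (key' : Fin h.m → β) (hk : ∀ i j, lin i → lin j → (key' i < key' j ↔ key i < key j)) :
    KeyedLinearization n h lin lout key' src := by
  have he : ∀ i j, lin i → lin j → (key' i = key' j ↔ key i = key j) := by
    intro i j hi hj
    rw [← not_iff_not, ← Ne, ← Ne, ne_iff_lt_or_gt, ne_iff_lt_or_gt, hk i j hi hj, hk j i hj hi]
  have hs : ∀ i x, lin i → lout i = QueueRes.val x → lin (src i) :=
    fun i x hi hx => (H.src_spec i x hi hx).1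
  refine
    { H with
      order := fun i j hp hi hj => (hk i j hi hj).2 (H.order i j hp hi hj)
      single := fun i j hi hj hij => H.single i j hi hj ((he i j hi hj).1 hij)
      src_spec := fun i x hi hx => ?_
      src_key := fun i x j y hi hx hj hy => (H.src_key i x j y hi hx hj hy).trans (he i j hi hj).symm
      fifo := fun i x j y hi hx hj hy hlt => ?_
      empty := fun i j y hi hx hj hy hlt => ?_
      card := fun i x hi hx C hC => H.card i x hi hx C fun j hj =>
        ⟨(hC j hj).1, (he j i (hC j hj).1 hi).1 (hC j hj).2⟩ }
  · obtain ⟨h1, h2, h3⟩ := H.src_spec i x hi hx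
    exact ⟨h1, h2, (hk _ _ h1 hi).2 h3⟩
  · obtain ⟨i', h1, h2, h3, h4⟩ := H.fifo i x j y hi hx hj hy ((hk _ _ hj (hs i x hi hx)).1 hlt)
    exact ⟨i', h1, h2, h3, (hk _ _ h1 hi).2 h4⟩
  · obtain ⟨i', h1, h2, h3, h4⟩ := H.empty i j y hi hx hj hy ((hk _ _ hj hi).1 hlt)
    exact ⟨i', h1, h2, h3, (hk _ _ h1 hi).2 h4⟩

theorem KeyedLinearization.setLinearizable_of_surj {n K : ℕ} {h : ConcHistory QueueOp QueueRes}
    {lin : Fin h.m → Prop} {lout : Fin h.m → QueueRes} {key : Fin h.m → ℕ}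
    {src : Fin h.m → Fin h.m} (H : KeyedLinearization n h lin lout key src)
    (hlt : ∀ i, lin i → key i < K) (hsurj : ∀ k < K, ∃ i, lin i ∧ key i = k) :
    SetLinearizable n h := by
  classical
  have hkindE : ∀ i x, lin i → h.op i = QueueOp.enq x → lout i = QueueRes.ok := by
    intro i x hi hx
    rcases H.kind i hi with ⟨_, _, h1⟩ | ⟨h1, _⟩ | ⟨h1, _⟩
    · exact h1
    all_goals rw [h1] at hx; cases hx
  have huniq : ∀ i x j, lin i → h.op i = QueueOp.enq x → lin j → key j = key i → j = i := by
    intro i x j hi hx hj hk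
    rcases H.single i j hi hj hk.symm with h1 | ⟨⟨y, h1⟩, _⟩
    · exact h1.symm
    · rw [hkindE i x hi hx] at h1; cases h1
  have hv : ∀ k, ∃ v, ∀ i x, lin i → h.op i = QueueOp.enq x → key i = k → v = x := by
    intro k
    by_cases hex : ∃ i x, lin i ∧ h.op i = QueueOp.enq x ∧ key i = k
    · obtain ⟨i, x, hi, hx, rfl⟩ := hex
      refine ⟨x, fun j y hj hy hk => ?_⟩
      rw [huniq i x j hi hx hj hk, hx] at hy
      exact QueueOp.enq.inj hy
    · exact ⟨0, fun i x hi hx hk => absurd ⟨i, x, hi, hx, hk⟩ hex⟩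
  have hd : ∀ k, ∃ d, (∀ i x, lin i → lout i = QueueRes.val x → key (src i) = k → d = key i) ∧
      ((¬ ∃ i x, lin i ∧ lout i = QueueRes.val x ∧ key (src i) = k) → d = K) := by
    intro k
    by_cases hex : ∃ i x, lin i ∧ lout i = QueueRes.val x ∧ key (src i) = k
    · obtain ⟨i, x, hi, hx, rfl⟩ := hex
      refine ⟨key i, fun j y hj hy hk => ?_, fun hn => absurd ⟨i, x, hi, hx, rfl⟩ hn⟩
      obtain ⟨h1, h2, h3⟩ := H.src_spec i x hi hx
      obtain ⟨h4, h5, h6⟩ := H.src_spec j y hj hy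
      exact (H.src_key i x j y hi hx hj hy).1 (huniq _ _ _ h4 h5 h1 hk.symm)
    · exact ⟨K, fun i x hi hx hk => absurd ⟨i, x, hi, hx, hk⟩ hex, fun _ => rfl⟩
  choose v hv using hv
  choose d hd hd' using hd
  set E : Set ℕ := {k | ∃ i x, lin i ∧ h.op i = QueueOp.enq x ∧ key i = k} with hE
  have hdE : ∀ j ∈ E, d j < K → ∃ i x, lin i ∧ lout i = QueueRes.val x ∧ key (src i) = j ∧
      d j = key i := by
    intro j _ hjK
    by_contra hn
    have := hd' j (fun ⟨i, x, hi, hx, hk⟩ => hn ⟨i, x, hi, hx, hk, hd j i x hi hx hk⟩)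
    omega
  let cls : Fin h.m → Option (Fin K) := fun i =>
    if hi : lin i then some ⟨key i, hlt i hi⟩ else none
  have hcls : ∀ i (k : Fin K), cls i = some k ↔ lin i ∧ key i = k := by
    intro i k
    by_cases hi : lin i <;> simp [cls, hi, Fin.ext_iff]
  refine ⟨⟨K, cls, lout, fun k => queueContents E d v k, ?_, H.out_agree, ?_, ?_, ?_, ?_⟩⟩
  · intro i hi
    simp [cls, H.complete i hi]
  · simp [queueContents]
  · intro k
    obtain ⟨i, hi, hk⟩ := hsurj k k.2
    exact ⟨i, (hcls i k).2 ⟨hi, hk⟩⟩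
  · intro k
    obtain ⟨i, hi, hk⟩ := hsurj k k.2
    have hkK := k.2
    simp only [Fin.val_castSucc, Fin.val_succ]
    have hsingle : (∀ x, lout i ≠ QueueRes.val x) →
        univ.filter (fun j => cls j = some k) = {i} := by
      intro hne
      ext j
      simp only [mem_filter, mem_univ, true_and, mem_singleton, hcls]
      constructor
      · rintro ⟨hj, hjk⟩
        rcases H.single i j hi hj (by omega) with h1 | ⟨⟨x, h1⟩, _⟩
        · exact h1.symm
        · exact absurd h1 (hne x)
      · rintro rfl
        exact ⟨hi, hk⟩
    have hnE : h.op i = QueueOp.deq → (k : ℕ) ∉ E := by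
      rintro hop ⟨j, x, hj, hx, hjk⟩
      rw [huniq j x i hj hx hi (by omega), hx] at hop
      cases hop
    rcases H.kind i hi with ⟨x, hop, hout⟩ | ⟨hop, x, hout⟩ | ⟨hop, hout⟩
    · left
      refine ⟨i, x, hsingle (by simp [hout]), hop, hout, ?_⟩
      have hvx := hv k i x hi hop hk
      rw [← hvx]
      apply queueContents_enq
      · exact ⟨i, x, hi, hop, hk⟩
      · by_cases hdk : d k < K
        · obtain ⟨j, y, hj, hy, h1, h2⟩ := hdE k ⟨i, x, hi, hop, hk⟩ hdk
          have := (H.src_spec j y hj hy).2.2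
          omega
        · omega
      · intro j hj _ hjk
        obtain ⟨a, y, ha, hy, h1, h2⟩ := hdE j hj (by omega)
        rw [huniq i x a hi hop ha (by omega), hout] at hy
        cases hy
    · right; left
      obtain ⟨h1, h2, h3⟩ := H.src_spec i x hi hout
      have hdi := hd _ i x hi hout rfl
      refine ⟨x, ?_, ?_, ?_, ?_⟩
      · rw [← hv _ _ _ h1 h2 rfl]
        apply queueContents_deq v (hnE hop)
        · exact ⟨_, x, h1, h2, rfl⟩
        · omega
        · omega
        · rintro j ⟨a, y, ha, hy, rfl⟩ hja
          obtain ⟨i', h4, ⟨z, h5⟩, h6, h7⟩ := H.fifo i x a y hi hout ha hy hja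
          rw [hd _ i' z h4 h5 (by rw [h6])]
          omega
        · intro j hj hjk
          obtain ⟨a, y, ha, hy, h4, h5⟩ := hdE j hj (by omega)
          rw [← h4, (H.src_key a y i x ha hy hi hout).2 (by omega)]
      · exact card_pos.2 ⟨i, by simp [hcls, hi, hk]⟩
      · refine H.card i x hi hout _ fun j hj => ?_
        simp only [mem_filter, mem_univ, true_and, hcls] at hj
        exact ⟨hj.1, by omega⟩
      · intro j hj
        simp only [mem_filter, mem_univ, true_and, hcls] at hj
        obtain ⟨y, hy⟩ : ∃ y, lout j = QueueRes.val y := by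
          rcases H.single i j hi hj.1 (by omega) with rfl | h4
          · exact ⟨x, hout⟩
          · exact h4.2
        obtain ⟨h4, h5, h6⟩ := H.src_spec j y hj.1 hy
        rw [← (H.src_key i x j y hi hout hj.1 hy).2 (by omega), h2] at h5
        refine ⟨?_, by rw [hy, QueueOp.enq.inj h5]⟩
        rcases H.kind j hj.1 with ⟨_, _, h7⟩ | ⟨h7, _⟩ | ⟨h7, _⟩
        · rw [hy] at h7; cases h7
        all_goals exact h7
    · right; right
      have := queueContents_empty (E := E) (d := d) v (k := k) (hnE hop) (by
        rintro j ⟨a, y, ha, hy, rfl⟩ hja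
        obtain ⟨i', h4, ⟨z, h5⟩, h6, h7⟩ := H.empty i a y hi hout ha hy (by omega)
        rw [hd _ i' z h4 h5 (by rw [h6])]
        omega)
      exact ⟨i, hsingle (by simp [hout]), hop, hout, this.1, this.2⟩
  · intro i j ki kj hp hi hj
    rw [hcls] at hi hj
    rw [← hi.2, ← hj.2]
    exact H.order i j hp hi.1 hj.1

theorem KeyedLinearization.setLinearizable {α : Type*} [LinearOrder α] {n : ℕ}
    {h : ConcHistory QueueOp QueueRes} {lin : Fin h.m → Prop} {lout : Fin h.m → QueueRes}
    {key : Fin h.m → α} {src : Fin h.m → Fin h.m} (H : KeyedLinearization n h lin lout key src) :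
    SetLinearizable n h := by
  classical
  set S : Finset α := (univ.filter lin).image key with hS
  have hmem : ∀ i, lin i → key i ∈ S := fun i hi =>
    mem_image_of_mem _ (mem_filter.2 ⟨mem_univ i, hi⟩)
  let e := S.orderIsoOfFin rfl
  let key' : Fin h.m → ℕ := fun i => if hi : lin i then (e.symm ⟨key i, hmem i hi⟩ : ℕ) else 0
  have hkey' : ∀ i (hi : lin i), key' i = e.symm ⟨key i, hmem i hi⟩ := fun i hi => by
    simp [key', hi]
  refine (H.rekey key' ?_).setLinearizable_of_surj (K := S.card) ?_ ?_
  · intro i j hi hj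
    rw [hkey' i hi, hkey' j hj, Fin.val_fin_lt, OrderIso.lt_iff_lt, Subtype.mk_lt_mk]
  · intro i hi
    rw [hkey' i hi]
    exact (e.symm _).2
  · intro k hk
    obtain ⟨i, hi, hik⟩ := mem_image.1 (e ⟨k, hk⟩).2
    have hi' := (mem_filter.1 hi).2
    refine ⟨i, hi', ?_⟩
    rw [hkey' i hi']
    have : (⟨key i, hmem i hi'⟩ : S) = e ⟨k, hk⟩ := Subtype.ext hik
    rw [this, OrderIso.symm_apply_apply]

/-- The operation `op` invoked at time `t₀` is determined to return `res` by step `w`, acting on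
the entry `p` of `Items` or, if `res` is `ε`, observing that no item is present in
configuration `τ`. -/
def Effect {n : ℕ} (c : ℕ → Config n) (sched : ℕ → Fin n) (op : QueueOp) (t₀ : ℕ)
    (res : QueueRes) (w : ℕ) (p : ℕ × ℕ) (τ : ℕ) : Prop :=
  (∃ x, op = QueueOp.enq x ∧ res = QueueRes.ok ∧ Enqueues c sched x t₀ w p) ∨
    (∃ x, op = QueueOp.deq ∧ res = QueueRes.val x ∧ Dequeues c sched x t₀ w p) ∨
    (op = QueueOp.deq ∧ res = QueueRes.empty ∧ FindsEmpty c sched t₀ w τ)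

/-- The position of an operation in the linearization. -/
noncomputable def effectKey {n : ℕ} (c : ℕ → Config n) (N : ℕ) (res : QueueRes) (w : ℕ)
    (p : ℕ × ℕ) (τ : ℕ) : ℕ ×ₗ ℕ :=
  match res with
  | QueueRes.ok => toLex (2 * enqTime c N p, markTime c N p)
  | QueueRes.val _ => toLex (2 * markTime c N p, N + 2)
  | QueueRes.empty => toLex (2 * τ + 1, w)

theorem Decides.exists_effect {n : ℕ} {c : ℕ → Config n} {sched : ℕ → Fin n} {op : QueueOp}
    {t₀ : ℕ} {res : QueueRes} {w : ℕ} (hd : Decides c sched op t₀ res w) (h : Run c sched) :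
    ∃ p τ, Effect c sched op t₀ res w p τ := by
  rcases hd.cases h with ⟨x, p, h1⟩ | ⟨x, p, h1⟩ | ⟨h1, h2, τ, h3⟩
  · exact ⟨p, 0, Or.inl ⟨x, h1⟩⟩
  · exact ⟨p, 0, Or.inr (Or.inl ⟨x, h1⟩)⟩
  · exact ⟨(0, 0), τ, Or.inr (Or.inr ⟨h1, h2, h3⟩)⟩

section Effect

variable {n : ℕ} {c : ℕ → Config n} {sched : ℕ → Fin n} {op : QueueOp} {t₀ : ℕ} {res : QueueRes}
  {w τ N : ℕ} {p : ℕ × ℕ}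

theorem Effect.decides (he : Effect c sched op t₀ res w p τ) : Decides c sched op t₀ res w := by
  rcases he with ⟨x, rfl, rfl, h1⟩ | ⟨x, rfl, rfl, h1⟩ | ⟨rfl, rfl, h1⟩
  all_goals exact h1.decides

theorem Effect.enqueues {x : ℕ} (he : Effect c sched (QueueOp.enq x) t₀ res w p τ) :
    res = QueueRes.ok ∧ Enqueues c sched x t₀ w p := by
  rcases he with ⟨x, h0, rfl, h1⟩ | ⟨x, h0, _⟩ | ⟨h0, _⟩ <;> cases h0
  exact ⟨rfl, h1⟩

theorem Effect.dequeues {x : ℕ} (he : Effect c sched op t₀ (QueueRes.val x) w p τ) :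
    op = QueueOp.deq ∧ Dequeues c sched x t₀ w p := by
  rcases he with ⟨x, _, h0, h1⟩ | ⟨x, h2, h0, h1⟩ | ⟨_, h0, _⟩ <;> cases h0
  exact ⟨h2, h1⟩

theorem Effect.findsEmpty (he : Effect c sched op t₀ QueueRes.empty w p τ) :
    op = QueueOp.deq ∧ FindsEmpty c sched t₀ w τ := by
  rcases he with ⟨x, _, h0, h1⟩ | ⟨x, h2, h0, h1⟩ | ⟨h2, h0, h1⟩ <;> cases h0
  exact ⟨h2, h1⟩

theorem Enqueues.written {x : ℕ} (he : Enqueues c sched x t₀ w p) (h : Run c sched)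
    (hw : w < N) : (c N).items p.1 p.2 ≠ Cell.bot :=
  (Run.later h hw).ne_bot (by simp [he.val])

theorem Effect.key_bounds (he : Effect c sched op t₀ res w p τ) (h : Run c sched) (hw : w < N) :
    2 * t₀ < (ofLex (effectKey c N res w p τ)).1 ∧
      (ofLex (effectKey c N res w p τ)).1 ≤ 2 * (w + 1) := by
  rcases he with ⟨x, rfl, rfl, h1⟩ | ⟨x, rfl, rfl, h1⟩ | ⟨rfl, rfl, h1⟩
  · have h2 := h1.written h hw
    have h3 := h1.lt_enqTime h h2
    have h4 := enqTime_le_writeTime h2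
    have h5 := h1.writeTime_eq h
    simp only [effectKey, ofLex_toLex]
    omega
  · have := h1.facts h hw
    simp only [effectKey, ofLex_toLex]
    omega
  · have := h1.lt
    have := h1.lt_step
    simp only [effectKey, ofLex_toLex]
    omega

end Effect

theorem lex_lt_iff {a b a' b' : ℕ} :
    (toLex (a, b) : ℕ ×ₗ ℕ) < toLex (a', b') ↔ a < a' ∨ a = a' ∧ b < b' :=
  Prod.Lex.toLex_lt_toLex

theorem Run.setLinearizable {n : ℕ} {c : ℕ → Config n} {sched : ℕ → Fin n} (h : Run c sched)
    (N : ℕ) : SetLinearizable n (historyAt (c N)) := by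
  classical
  set H := historyAt (c N) with hH
  let lin : Fin H.m → Prop := fun a => ∃ res, ∃ w < N, Decides c sched (H.op a) (H.inv a) res w
  have hdata : ∀ a, ∃ res w p τ, lin a → w < N ∧ Effect c sched (H.op a) (H.inv a) res w p τ := by
    intro a
    by_cases ha : lin a
    · obtain ⟨res, w, hw, hd⟩ := ha
      obtain ⟨p, τ, he⟩ := hd.exists_effect h
      exact ⟨res, w, p, τ, fun _ => ⟨hw, he⟩⟩
    · exact ⟨QueueRes.ok, 0, (0, 0), 0, fun h' => absurd h' ha⟩
  choose res w p τ hdata using hdata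
  have hinj : ∀ {a b}, lin a → lin b → w a = w b → a = b := by
    intro a b ha hb hab
    have h1 := (hdata a ha).2.decides.pend
    have h2 := (hdata b hb).2.decides.pend
    rw [hab, h2] at h1
    simp only [Option.some.injEq, Prod.mk.injEq] at h1
    exact Run.historyAt_inj h h1.2.symm
  have hlin : ∀ {op t₀ r v}, Decides c sched op t₀ r v → v < N →
      ∃ a, lin a ∧ H.op a = op ∧ H.inv a = t₀ ∧ res a = r ∧ w a = v := by
    intro op t₀ r v hd hv
    obtain ⟨a, rfl, rfl⟩ := hd.exists_historyAt h hv
    have ha : lin a := ⟨r, v, hv, hd⟩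
    obtain ⟨h1, _, h2⟩ := (hdata a ha).2.decides.unique hd h
    exact ⟨a, ha, rfl, rfl, h2, h1⟩
  have henq : ∀ a x, lin a → H.op a = QueueOp.enq x →
      res a = QueueRes.ok ∧ Enqueues c sched x (H.inv a) (w a) (p a) := by
    intro a x ha hx
    have := (hdata a ha).2
    rw [hx] at this
    exact this.enqueues
  have hdeq : ∀ a x, lin a → res a = QueueRes.val x →
      H.op a = QueueOp.deq ∧ Dequeues c sched x (H.inv a) (w a) (p a) := by
    intro a x ha hx
    have := (hdata a ha).2
    rw [hx] at this
    exact this.dequeues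
  have hemp : ∀ a, lin a → res a = QueueRes.empty →
      H.op a = QueueOp.deq ∧ FindsEmpty c sched (H.inv a) (w a) (τ a) := by
    intro a ha hx
    have := (hdata a ha).2
    rw [hx] at this
    exact this.findsEmpty
  have henq_inj : ∀ {a x b y}, lin a → H.op a = QueueOp.enq x → lin b → H.op b = QueueOp.enq y →
      p a = p b → a = b := by
    intro a x b y ha hx hb hy hab
    have h1 := (henq a x ha hx).2.writeTime_eq h
    have h2 := (henq b y hb hy).2.writeTime_eq h
    rw [hab] at h1
    exact hinj ha hb (by omega)
  have hsrc : ∀ a, ∃ b, ∀ x, lin a → res a = QueueRes.val x →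
      lin b ∧ H.op b = QueueOp.enq x ∧ p b = p a := by
    intro a
    by_cases ha : lin a ∧ ∃ x, res a = QueueRes.val x
    · obtain ⟨ha, x, hx⟩ := ha
      have h1 := (hdeq a x ha hx).2
      have hwr := (h1.facts h (hdata a ha).1).1
      obtain ⟨v, hv, h2, _, y, t₀, h3⟩ := Run.writeTime_lt_markTime h hwr
      obtain rfl := h1.enqueues_val h3 h
      obtain ⟨b, hb, hop, _, _, h4⟩ := hlin h3.decides hv
      refine ⟨b, fun x' _ hx' => ?_⟩
      rw [hx] at hx'
      obtain rfl := QueueRes.val.inj hx'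
      have h5 := (henq b x hb hop).2
      refine ⟨hb, hop, Run.writeTime_inj h (h5.written h (hdata b hb).1) hwr ?_⟩
      rw [h5.writeTime_eq h, h2, h4]
    · exact ⟨a, fun x h1 h2 => absurd ⟨h1, x, h2⟩ ha⟩
  choose src hsrc using hsrc
  have htaken : ∀ j y, lin j → H.op j = QueueOp.enq y → markTime c N (p j) ≤ N →
      ∃ i, lin i ∧ (∃ z, res i = QueueRes.val z) ∧ p i = p j ∧ src i = j := by
    intro j y hj hy hm
    obtain ⟨v, hv, h1, h2, h3, x, t₀, h4⟩ := Run.exists_dequeues h hm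
    obtain ⟨i, hi, _, _, hx, hw⟩ := hlin h4.decides hv
    have h5 := (hdeq i x hi hx).2
    have hp : p i = p j := by
      obtain ⟨_, _, _, h6⟩ := h4.proc
      obtain ⟨_, _, _, h7⟩ := h5.proc
      rw [hw, h6] at h7
      simp only [PS.deqWrite.injEq] at h7
      exact Prod.ext h7.2.2.2.1.symm h7.2.2.2.2.1.symm
    obtain ⟨h8, h9, h10⟩ := hsrc i x hi hx
    exact ⟨i, hi, ⟨x, hx⟩, hp, henq_inj h8 h9 hj hy (h10.trans hp)⟩
  let key : Fin H.m → ℕ ×ₗ ℕ := fun a => effectKey c N (res a) (w a) (p a) (τ a)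
  have hkey_ok : ∀ a, res a = QueueRes.ok →
      key a = toLex (2 * enqTime c N (p a), markTime c N (p a)) := by
    intro a ha
    simp only [key, ha, effectKey]
  have hkey_val : ∀ a x, res a = QueueRes.val x →
      key a = toLex (2 * markTime c N (p a), N + 2) := by
    intro a x ha
    simp only [key, ha, effectKey]
  have hkey_empty : ∀ a, res a = QueueRes.empty → key a = toLex (2 * τ a + 1, w a) := by
    intro a ha
    simp only [key, ha, effectKey]
  have hkind : ∀ i, lin i → (∃ x, H.op i = QueueOp.enq x ∧ res i = QueueRes.ok) ∨
      (H.op i = QueueOp.deq ∧ ∃ x, res i = QueueRes.val x) ∨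
      (H.op i = QueueOp.deq ∧ res i = QueueRes.empty) := by
    intro i hi
    rcases (hdata i hi).2 with ⟨x, h1, h2, _⟩ | ⟨x, h1, h2, _⟩ | ⟨h1, h2, _⟩
    · exact Or.inl ⟨x, h1, h2⟩
    · exact Or.inr (Or.inl ⟨h1, x, h2⟩)
    · exact Or.inr (Or.inr ⟨h1, h2⟩)
  have hlog : ∀ {a : Fin H.m} {e : LogEntry n}, e ∈ (c N).log → H.op a = e.op → H.inv a = e.invT →
      lin a ∧ res a = e.res ∧ w a < e.retT := by
    intro a e he h1 h2
    obtain ⟨h3, v, h4, h5⟩ := Run.log_decides h he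
    rw [← h1, ← h2] at h5
    have ha : lin a := ⟨_, v, by omega, h5⟩
    obtain ⟨h6, _, h7⟩ := (hdata a ha).2.decides.unique h5 h
    exact ⟨ha, h7, by omega⟩
  have hsingle_val : ∀ i j x, lin i → lin j → res i = QueueRes.val x → key i = key j →
      (∃ y, res j = QueueRes.val y) ∧ p i = p j := by
    intro i j x hi hj hx hij
    have hfi := (hdeq i x hi hx).2.facts h (hdata i hi).1
    have hwi := (hdata i hi).1
    have h1 := markTime_le c N (p j)
    rw [hkey_val i x hx] at hij
    rcases hkind j hj with ⟨y, h2, h3⟩ | ⟨h2, y, h3⟩ | ⟨h2, h3⟩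
    · rw [hkey_ok j h3] at hij
      have := congrArg (fun k => (ofLex k).2) hij
      simp only [ofLex_toLex] at this
      omega
    · rw [hkey_val j y h3] at hij
      have := congrArg (fun k => (ofLex k).1) hij
      simp only [ofLex_toLex] at this
      exact ⟨⟨y, h3⟩, Run.markTime_inj (N := N) h (by omega) (by omega)⟩
    · rw [hkey_empty j h3] at hij
      have := congrArg (fun k => (ofLex k).1) hij
      simp only [ofLex_toLex] at this
      omega
  have hmain : KeyedLinearization n H lin res key src := by
    refine ⟨?_, ?_, hkind, ?_, ?_, ?_, ?_, ?_, ?_, ?_⟩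
    · intro i hi
      obtain ⟨r, hr⟩ := Option.isSome_iff_exists.1 hi
      obtain ⟨e, he, h1, h2, _⟩ := historyAt_of_out hr
      exact (hlog he h1 h2).1
    · intro i r hr
      obtain ⟨e, he, h1, h2, _, rfl⟩ := historyAt_of_out hr
      exact (hlog he h1 h2).2.1
    · rintro i j ⟨t, ht, hlt⟩ hi hj
      obtain ⟨e, he, h1, h2, rfl⟩ := historyAt_of_ret ht
      have h3 := (hlog he h1 h2).2.2
      have h4 := (hdata i hi).2.key_bounds h (hdata i hi).1
      have h5 := (hdata j hj).2.key_bounds h (hdata j hj).1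
      exact Prod.Lex.lt_iff.2 (Or.inl (by dsimp only [key]; omega))
    · intro i j hi hj hij
      rcases hkind i hi with ⟨x, h1, h2⟩ | ⟨h1, x, h2⟩ | ⟨h1, h2⟩
      · rcases hkind j hj with ⟨y, h3, h4⟩ | ⟨h3, y, h4⟩ | ⟨h3, h4⟩
        · left
          rw [hkey_ok i h2, hkey_ok j h4] at hij
          have h5 := congrArg (fun k => (ofLex k).1) hij
          have h6 := congrArg (fun k => (ofLex k).2) hij
          simp only [ofLex_toLex] at h5 h6
          exact henq_inj hi h1 hj h3 (Run.enqTime_inj h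
            ((henq i x hi h1).2.written h (hdata i hi).1)
            ((henq j y hj h3).2.written h (hdata j hj).1) h6 (by omega))
        · obtain ⟨⟨z, hz⟩, _⟩ := hsingle_val j i y hj hi h4 hij.symm
          rw [h2] at hz
          cases hz
        · rw [hkey_ok i h2, hkey_empty j h4] at hij
          have h5 := congrArg (fun k => (ofLex k).1) hij
          simp only [ofLex_toLex] at h5
          omega
      · exact Or.inr ⟨⟨x, h2⟩, (hsingle_val i j x hi hj h2 hij).1⟩
      · rcases hkind j hj with ⟨y, h3, h4⟩ | ⟨h3, y, h4⟩ | ⟨h3, h4⟩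
        · rw [hkey_empty i h2, hkey_ok j h4] at hij
          have h5 := congrArg (fun k => (ofLex k).1) hij
          simp only [ofLex_toLex] at h5
          omega
        · obtain ⟨⟨z, hz⟩, _⟩ := hsingle_val j i y hj hi h4 hij.symm
          rw [h2] at hz
          cases hz
        · left
          rw [hkey_empty i h2, hkey_empty j h4] at hij
          have h5 := congrArg (fun k => (ofLex k).2) hij
          exact hinj hi hj h5
    · intro i x hi hx
      obtain ⟨h1, h2, h3⟩ := hsrc i x hi hx
      refine ⟨h1, h2, ?_⟩
      obtain ⟨h4, h5⟩ := henq _ x h1 h2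
      have hwr := h5.written h (hdata _ h1).1
      have h6 := enqTime_le_writeTime hwr
      obtain ⟨v, _, h7, h8, _⟩ := Run.writeTime_lt_markTime h hwr
      rw [hkey_ok _ h4, hkey_val i x hx, lex_lt_iff, ← h3]
      omega
    · intro i x j y hi hx hj hy
      obtain ⟨h1, h2, h3⟩ := hsrc i x hi hx
      obtain ⟨h4, h5, h6⟩ := hsrc j y hj hy
      constructor
      · intro hij
        rw [hkey_val i x hx, hkey_val j y hy, ← h3, ← h6, hij]
      · intro hij
        exact henq_inj h1 h2 h4 h5
          (by rw [h3, h6, (hsingle_val i j x hi hj hx hij).2])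
    · intro i x j y hi hx hj hy hlt
      obtain ⟨h1, h2, h3⟩ := hsrc i x hi hx
      have hfi := (hdeq i x hi hx).2.facts h (hdata i hi).1
      have hwi := (hdata i hi).1
      have hej := henq j y hj hy
      rw [hkey_ok j hej.1, hkey_ok _ (henq _ x h1 h2).1, lex_lt_iff, h3] at hlt
      have hm : markTime c N (p j) < markTime c N (p i) := by
        by_contra hle
        rcases (not_lt.1 hle).eq_or_lt with heq | hgt
        · have := Run.markTime_inj h (by omega) heq
          rw [this] at hlt
          omega
        · have := enqTime_mono (hej.2.written h (hdata j hj).1) hgt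
          omega
      obtain ⟨i', h4, ⟨z, h5⟩, h6, h7⟩ := htaken j y hj hy (by omega)
      refine ⟨i', h4, ⟨z, h5⟩, h7, ?_⟩
      rw [hkey_val i' z h5, hkey_val i x hx, lex_lt_iff, h6]
      omega
    · intro i j y hi hx hj hy hlt
      have hei := (hemp i hi hx).2
      have hwi := (hdata i hi).1
      have hτ := hei.lt_step
      have hej := henq j y hj hy
      rw [hkey_ok j hej.1, hkey_empty i hx, lex_lt_iff] at hlt
      have hm := NoItem.markTime_le h hei.noItem (by omega : τ i ≤ N)
        (hej.2.written h (hdata j hj).1) (by omega)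
      obtain ⟨i', h4, ⟨z, h5⟩, h6, h7⟩ := htaken j y hj hy (by omega)
      refine ⟨i', h4, ⟨z, h5⟩, h7, ?_⟩
      rw [hkey_val i' z h5, hkey_empty i hx, lex_lt_iff, h6]
      omega
    · intro i x hi hx C hC
      have hpend : ∀ j ∈ C, (c (markTime c N (p i) - 1)).pend (sched (w j)) =
          some (QueueOp.deq, H.inv j) := by
        intro j hj
        obtain ⟨hjl, hjk⟩ := hC j hj
        obtain ⟨⟨y, hy⟩, hpij⟩ := hsingle_val i j x hi hjl hx hjk.symm
        obtain ⟨_, h1, h2, h3⟩ := (hdeq j y hjl hy).2.facts h (hdata j hjl).1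
        rw [hpij]
        exact h3 _ (by omega) (by omega)
      have hcard := card_le_card_of_injOn (s := C) (t := univ) (fun j => sched (w j))
        (fun _ _ => mem_coe.2 (mem_univ _)) (by
          intro a ha b hb hab
          have h1 := hpend a ha
          have h2 := hpend b hb
          dsimp only at hab
          rw [hab, h2] at h1
          simp only [Option.some.injEq, Prod.mk.injEq, true_and] at h1
          exact Run.historyAt_inj h h1.symm)
      simpa using hcard
  exact hmain.setLinearizable

end

/-- The algorithm SetSeqQueue — which uses only read/write base objects (an array of
read/write registers and a read/write wait-free linearizable counter, here taken
atomic since it is linearizable) — is a non-blocking set-linearizable implementation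
of the set-concurrent queue with multiplicity, and its `Enq` operation is moreover
wait-free: (1) a process that keeps being scheduled completes every `Enq` operation
it invokes, (2) in every infinite execution infinitely many invocations are
completed, and (3) every execution (assuming every item is enqueued at most once)
is set-linearizable. -/
theorem setSeqQueue_nonBlocking_setLinearizable_enqWaitFree (n : ℕ) (hn : 1 ≤ n) :
    (∀ (c : ℕ → Config n) (sched : ℕ → Fin n), Run c sched →
      ∀ i : Fin n, (∀ k, ∃ k' ≥ k, sched k' = i) →
        ∀ k x t, (c k).pend i = some (QueueOp.enq x, t) →
          ∃ k' > k, (c k').pend i = none) ∧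
    (∀ (c : ℕ → Config n) (sched : ℕ → Fin n), Run c sched →
      ∀ m : ℕ, ∃ k, m ≤ (c k).log.length) ∧
    (∀ (c : ℕ → Config n) (sched : ℕ → Fin n), Run c sched → ∀ N : ℕ,
      (∀ (i j : Fin (historyAt (c N)).m) (x : ℕ),
          (historyAt (c N)).op i = QueueOp.enq x →
          (historyAt (c N)).op j = QueueOp.enq x → i = j) →
      SetLinearizable n (historyAt (c N))) := by
  exact ⟨fun c sched h i hi k x t hp => Run.enq_completes h hi hp,
    fun c sched h m => Run.log_unbounded h m,
    fun c sched h N _ => Run.setLinearizable h N⟩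
end
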